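/- Let $\Gamma_6 = \mathbb{Z}^3 \rtimes \mathbb{Z}/4$ where the generator of $\mathbb{Z}/4$ acts on $\mathbb{Z}^3$ by the matrix $\begin{pmatrix} 0 & 1 & 0 \\ -1 & 0 & 1 \\ 0 & 0 & 1\end{pmatrix}$. Then $H^0(\Gamma_6,\mathbb{Z}) \cong H^1(\Gamma_6,\mathbb{Z}) \cong \mathbb{Z}$, $H^2(\Gamma_6,\mathbb{Z}) \cong \mathbb{Z}/4 \oplus \mathbb{Z}$, $H^3(\Gamma_6,\mathbb{Z}) \cong \mathbb{Z}/2 \oplus \mathbb{Z}$, and $H^i(\Gamma_6,\mathbb{Z}) \cong \mathbb{Z}/4 \oplus \mathbb{Z}/2$ for all $i \ge 4$. -/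

import Mathlib

/-- A homomorphism `ℤ/k →* M` determined by an element `σ` with `σ^k = 1`
(sending the canonical generator to `σ`). -/
def homOfPowEqOne {M : Type*} [Monoid M] (k : ℕ) [NeZero k] (σ : M) (hσ : σ ^ k = 1) :
    Multiplicative (ZMod k) →* M where
  toFun g := σ ^ (g.toAdd.val)
  map_one' := by simp
  map_mul' a b := by
    show σ ^ (Multiplicative.toAdd a + Multiplicative.toAdd b).val = _
    rw [ZMod.val_add, ← pow_eq_pow_mod _ hσ, pow_add]

/-- Automorphisms of a `ℤ`-module, viewed as multiplicative automorphisms of the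
underlying multiplicative abelian group. -/
def linAutToMulAut {L : Type*} [AddCommGroup L] [Module ℤ L] :
    (L ≃ₗ[ℤ] L) →* MulAut (Multiplicative L) where
  toFun e := AddEquiv.toMultiplicative e.toAddEquiv
  map_one' := rfl
  map_mul' _ _ := rfl

/-- The matrix `ρ₆(a)` giving the indecomposable integral representation of `ℤ/4`
on `ℤ³`. -/
def rho6 : Matrix (Fin 3) (Fin 3) ℤ := !![0, 1, 0; -1, 0, 1; 0, 0, 1]

/-- `ρ₆(a)` as a unit of the matrix ring (its inverse is `ρ₆(a)³`). -/
def rho6Unit : (Matrix (Fin 3) (Fin 3) ℤ)ˣ :=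
  ⟨rho6, rho6 ^ 3, by decide, by decide⟩

/-- The automorphism of `ℤ³` (written multiplicatively) given by `ρ₆(a)`. -/
noncomputable def rho6MulAut : MulAut (Multiplicative (Fin 3 → ℤ)) :=
  linAutToMulAut (LinearMap.GeneralLinearGroup.generalLinearEquiv ℤ (Fin 3 → ℤ)
    (Matrix.GeneralLinearGroup.toLin rho6Unit))

lemma rho6MulAut_pow_four : rho6MulAut ^ 4 = 1 := by
  have hu : rho6Unit ^ 4 = 1 := Units.ext (by decide)
  have : rho6MulAut ^ 4 = linAutToMulAut
      (LinearMap.GeneralLinearGroup.generalLinearEquiv ℤ (Fin 3 → ℤ)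
        (Matrix.GeneralLinearGroup.toLin (rho6Unit ^ 4))) := by
    simp [rho6MulAut, map_pow]
  rw [this, hu, map_one, map_one, map_one]

/-- The action of `ℤ/4` on `ℤ³` in which the generator acts by the matrix `ρ₆(a)`. -/
noncomputable def rho6Action : Multiplicative (ZMod 4) →* MulAut (Multiplicative (Fin 3 → ℤ)) :=
  homOfPowEqOne 4 rho6MulAut rho6MulAut_pow_four

/-- The crystallographic group `Γ₆ = ℤ³ ⋊ ℤ/4` associated to `ρ₆`. -/
noncomputable abbrev Gamma6 :=
  SemidirectProduct (Multiplicative (Fin 3 → ℤ)) (Multiplicative (ZMod 4)) rho6Action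

/-- group ring of the lattice -/
abbrev S6 := MonoidAlgebra ℤ (Multiplicative (Fin 3 → ℤ))
/-- group ring of `Gamma6` -/
abbrev R6 := MonoidAlgebra ℤ Gamma6

namespace G6

lemma act_one (v : Fin 3 → ℤ) : rho6Action (Multiplicative.ofAdd 1) (Multiplicative.ofAdd v) =
    Multiplicative.ofAdd ![v 1, v 2 - v 0, v 2] := by
  apply Multiplicative.toAdd.injective
  show rho6.mulVec v = _
  ext i; fin_cases i <;> simp [rho6, Matrix.mulVec, dotProduct, Fin.sum_univ_three]
  ring

/-- monomials in `S6` -/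
noncomputable def t (v : Fin 3 → ℤ) : S6 := MonoidAlgebra.single (Multiplicative.ofAdd v) 1

lemma t_mul (v w : Fin 3 → ℤ) : t v * t w = t (v + w) := by
  simp [t, MonoidAlgebra.single_mul_single, ← ofAdd_add]

lemma t_zero : t 0 = 1 := rfl

lemma t_ne (v : Fin 3 → ℤ) (h : v ≠ 0) : t v - 1 ≠ 0 := by
  rw [sub_ne_zero, ← t_zero]
  intro h1
  apply h
  have := (MonoidAlgebra.single_left_inj (R := ℤ) one_ne_zero).1 h1
  exact Multiplicative.ofAdd.injective this

/-- inclusion of `S6` into `R6` -/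
noncomputable def ι : S6 →+* R6 := MonoidAlgebra.mapDomainRingHom ℤ SemidirectProduct.inl

lemma ι_single (l : Multiplicative (Fin 3 → ℤ)) (n : ℤ) :
    ι (MonoidAlgebra.single l n) = MonoidAlgebra.single (SemidirectProduct.inl l) n := by
  simp [ι]

/-- the generator of `ℤ/4` in `R6` -/
noncomputable def a : R6 := MonoidAlgebra.single (SemidirectProduct.inr (Multiplicative.ofAdd 1)) 1

lemma a_mul_single (g : Multiplicative (ZMod 4)) (n : ℤ) :
    (MonoidAlgebra.single (SemidirectProduct.inr g) n : R6) * a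
      = MonoidAlgebra.single (SemidirectProduct.inr (g * Multiplicative.ofAdd 1)) n := by
  simp [a, MonoidAlgebra.single_mul_single]

lemma a2 : a * a = MonoidAlgebra.single (SemidirectProduct.inr (Multiplicative.ofAdd 2)) 1 := by
  exact a_mul_single (Multiplicative.ofAdd 1) 1

lemma a3 : a * a * a = MonoidAlgebra.single (SemidirectProduct.inr (Multiplicative.ofAdd 3)) 1 := by
  rw [a2, a_mul_single]; rfl

lemma a4 : a * a * a * a = 1 := by
  rw [a3, a_mul_single]; rfl

/-- conjugation by `a` on `S6` -/
noncomputable def α : S6 →+* S6 :=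
  MonoidAlgebra.mapDomainRingHom ℤ (rho6Action (Multiplicative.ofAdd 1)).toMonoidHom

lemma a_ι (s : S6) : a * ι s = ι (α s) * a := by
  induction s using MonoidAlgebra.induction_linear with
  | zero => simp
  | add x y hx hy => simp [mul_add, add_mul, hx, hy]
  | single l n =>
    simp only [α, MonoidAlgebra.mapDomainRingHom_apply, MonoidAlgebra.mapDomain_single, ι_single, a,
      MonoidAlgebra.single_mul_single, one_mul, mul_one]
    congr 1
    ext <;> simp

lemma α_t (v : Fin 3 → ℤ) : α (t v) = t ![v 1, v 2 - v 0, v 2] := by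
  simp only [α, t, MonoidAlgebra.mapDomainRingHom_apply, MonoidAlgebra.mapDomain_single]
  rw [← act_one]; rfl

lemma decomp (x : R6) : ∃ s0 s1 s2 s3 : S6,
    x = ι s0 + ι s1 * a + ι s2 * (a * a) + ι s3 * (a * a * a) := by
  induction x using MonoidAlgebra.induction_linear with
  | zero => exact ⟨0, 0, 0, 0, by simp⟩
  | add x y hx hy =>
    obtain ⟨x0, x1, x2, x3, rfl⟩ := hx
    obtain ⟨y0, y1, y2, y3, rfl⟩ := hy
    refine ⟨x0 + y0, x1 + y1, x2 + y2, x3 + y3, ?_⟩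
    simp only [map_add, add_mul]; abel
  | single g n =>
    have key : (MonoidAlgebra.single g n : R6) = ι (MonoidAlgebra.single g.left n) *
        MonoidAlgebra.single (SemidirectProduct.inr g.right) 1 := by
      rw [ι_single, MonoidAlgebra.single_mul_single]
      simp [SemidirectProduct.inl_left_mul_inr_right]
    rw [key]
    generalize MonoidAlgebra.single g.left n = s
    generalize g.right = k
    obtain ⟨k, rfl⟩ := Multiplicative.ofAdd.surjective k
    have : k = 0 ∨ k = 1 ∨ k = 2 ∨ k = 3 := by revert k; decide
    rcases this with rfl | rfl | rfl | rfl
    · refine ⟨s, 0, 0, 0, ?_⟩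
      simp [← MonoidAlgebra.one_def]
    · refine ⟨0, s, 0, 0, ?_⟩
      simp [a]
    · refine ⟨0, 0, s, 0, ?_⟩
      simp [a2]
    · refine ⟨0, 0, 0, s, ?_⟩
      simp [a3]

/-- coordinates -/
noncomputable def c : R6 →+ (Multiplicative (ZMod 4) → S6) :=
  (Finsupp.liftAddHom (fun g : Gamma6 =>
    (AddMonoidHom.single (fun _ : Multiplicative (ZMod 4) => S6) g.right).comp
      (MonoidAlgebra.singleAddHom g.left))).comp
    (MonoidAlgebra.coeffAddEquiv : R6 ≃+ _).toAddMonoidHom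

lemma c_single (g : Gamma6) (n : ℤ) :
    c (MonoidAlgebra.single g n) = Pi.single g.right (MonoidAlgebra.single g.left n) := by
  simp [c]

lemma c_ι (s : S6) (k : Multiplicative (ZMod 4)) :
    c (ι s * MonoidAlgebra.single (SemidirectProduct.inr k) 1) = Pi.single k s := by
  induction s using MonoidAlgebra.induction_linear with
  | zero => simp
  | add x y hx hy => simp [add_mul, hx, hy, Pi.single_add]
  | single l n =>
    rw [ι_single, MonoidAlgebra.single_mul_single, c_single]
    simp

lemma indep {s0 s1 s2 s3 : S6}
    (h : ι s0 + ι s1 * a + ι s2 * (a * a) + ι s3 * (a * a * a) = 0) :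
    s0 = 0 ∧ s1 = 0 ∧ s2 = 0 ∧ s3 = 0 := by
  have h1 : ι s0 = ι s0 * MonoidAlgebra.single (SemidirectProduct.inr (Multiplicative.ofAdd 0)) 1 := by
    simp [← MonoidAlgebra.one_def]
  rw [h1, a3, a2, a] at h
  have h2 := congrArg c h
  simp only [map_add, c_ι, map_zero] at h2
  refine ⟨?_, ?_, ?_, ?_⟩
  · simpa +decide [Pi.single_apply] using congrFun h2 (Multiplicative.ofAdd 0)
  · simpa +decide [Pi.single_apply] using congrFun h2 (Multiplicative.ofAdd 1)
  · simpa +decide [Pi.single_apply] using congrFun h2 (Multiplicative.ofAdd 2)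
  · simpa +decide [Pi.single_apply] using congrFun h2 (Multiplicative.ofAdd 3)

lemma t_zsmul_sub (w : Fin 3 → ℤ) (n : ℤ) : t w - 1 ∣ t (n • w) - 1 := by
  have hn : ∀ k : ℕ, t w - 1 ∣ t (k • w) - 1 := by
    intro k
    induction k with
    | zero => simp [t_zero]
    | succ k ih =>
      have : t ((k + 1) • w) - 1 = (t (k • w) - 1) * t w + (t w - 1) := by
        rw [sub_mul, t_mul, add_smul, one_smul]; ring
      rw [this]
      exact dvd_add (ih.mul_right _) dvd_rfl
  obtain ⟨k, rfl | rfl⟩ := n.eq_nat_or_neg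
  · rw [natCast_zsmul]; exact hn k
  · have : t (-(k : ℤ) • w) - 1 = - t (-(k : ℤ) • w) * (t (k • w) - 1) := by
      have h : t (-(k : ℤ) • w) * t (k • w) = 1 := by
        rw [t_mul, ← t_zero]; congr 1; simp
      linear_combination h
    rw [this]; exact (hn k).mul_left _

/-- projection killing `z` -/
def pz : (Fin 3 → ℤ) →+ (Fin 3 → ℤ) where
  toFun v := ![0, v 1 - v 0, v 2 - 2 * v 0]
  map_zero' := by ext i; fin_cases i <;> simp
  map_add' v w := by ext i; fin_cases i <;> simp <;> ring

/-- projection killing `z` and `Y` -/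
def pzy : (Fin 3 → ℤ) →+ (Fin 3 → ℤ) where
  toFun v := ![0, 0, v 2 - v 0 - v 1]
  map_zero' := by ext i; fin_cases i <;> simp
  map_add' v w := by ext i; fin_cases i <;> simp; ring

/-- induced ring maps -/
noncomputable def Pr (f : (Fin 3 → ℤ) →+ (Fin 3 → ℤ)) : S6 →+* S6 :=
  MonoidAlgebra.mapDomainRingHom ℤ (AddMonoidHom.toMultiplicative f)

lemma Pr_t (f : (Fin 3 → ℤ) →+ (Fin 3 → ℤ)) (v) : Pr f (t v) = t (f v) := by
  simp only [Pr, t, MonoidAlgebra.mapDomainRingHom_apply, MonoidAlgebra.mapDomain_single]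
  rfl

lemma single_eq (l : Multiplicative (Fin 3 → ℤ)) (n : ℤ) :
    (MonoidAlgebra.single l n : S6) = n • t l.toAdd := by
  simp [t]

lemma Pr_mem (f : (Fin 3 → ℤ) →+ (Fin 3 → ℤ)) (I : Ideal S6)
    (h : ∀ v, t v - t (f v) ∈ I) (s : S6) : s - Pr f s ∈ I := by
  induction s using MonoidAlgebra.induction_linear with
  | zero => simp
  | add x y hx hy => rw [map_add, add_sub_add_comm]; exact I.add_mem hx hy
  | single l n =>
    rw [single_eq, map_zsmul, Pr_t, ← smul_sub]
    exact zsmul_mem (h _) n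

/-- the basis vectors `z, Y, X` of the lattice -/
def zv : Fin 3 → ℤ := ![1, 1, 2]
/-- `Y` -/
def yv : Fin 3 → ℤ := ![0, 1, 1]
/-- `X` -/
def xv : Fin 3 → ℤ := ![0, 0, 1]

lemma S_z (s : S6) : s - Pr pz s ∈ Ideal.span {t zv - 1} := by
  apply Pr_mem
  intro v
  rw [Ideal.mem_span_singleton]
  have : t v - t (pz v) = t (pz v) * (t (v 0 • zv) - 1) := by
    rw [mul_sub, t_mul, mul_one]; congr 2
    ext i; fin_cases i <;> simp [pz, zv] 
    ring
  rw [this]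
  exact (t_zsmul_sub _ _).mul_left _

lemma S_zy (s : S6) : s - Pr pzy s ∈ Ideal.span {t zv - 1, t yv - 1} := by
  apply Pr_mem
  intro v
  have : t v - t (pzy v) = t (v - v 0 • zv) * (t (v 0 • zv) - 1) +
      t (pzy v) * (t ((v 1 - v 0) • yv) - 1) := by
    rw [mul_sub, t_mul, mul_one, mul_sub, t_mul, mul_one]
    have e1 : v - v 0 • zv + v 0 • zv = v := by simp
    have e2 : pzy v + (v 1 - v 0) • yv = v - v 0 • zv := by
      ext i; fin_cases i <;> simp [pzy, yv, zv]
      ring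
    rw [e1, e2]; ring
  rw [this]
  refine Ideal.add_mem _ (Ideal.mul_mem_left _ _ ?_) (Ideal.mul_mem_left _ _ ?_)
  · exact Ideal.mem_of_dvd _ (t_zsmul_sub _ _) (Ideal.subset_span (by simp))
  · exact Ideal.mem_of_dvd _ (t_zsmul_sub _ _) (Ideal.subset_span (by simp))

lemma S2 (s k : S6) (h : s * (t yv - 1) = k * (t zv - 1)) : ∃ m, s = m * (t zv - 1) := by
  have h1 := congrArg (Pr pz) h
  have e1 : pz zv = 0 := by decide
  have e2 : pz yv = yv := by decide
  simp only [map_mul, map_sub, map_one, Pr_t, e1, e2, t_zero, sub_self, mul_zero, mul_eq_zero] at h1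
  have h2 := S_z s
  rw [h1.resolve_right (t_ne _ (by decide)), sub_zero, Ideal.mem_span_singleton] at h2
  obtain ⟨m, hm⟩ := h2
  exact ⟨m, by rw [hm, mul_comm]⟩

lemma S3 (s k l : S6) (h : s * (t xv - 1) = k * (t zv - 1) + l * (t yv - 1)) :
    ∃ m n, s = m * (t zv - 1) + n * (t yv - 1) := by
  have h1 := congrArg (Pr pzy) h
  have e1 : pzy zv = 0 := by decide
  have e2 : pzy yv = 0 := by decide
  have e3 : pzy xv = xv := by decide
  simp only [map_mul, map_add, map_sub, map_one, Pr_t, e1, e2, e3, t_zero, sub_self, mul_zero,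
    add_zero, mul_eq_zero] at h1
  have h2 := S_zy s
  rw [h1.resolve_right (t_ne _ (by decide)), sub_zero, Ideal.mem_span_pair] at h2
  obtain ⟨m, n, hm⟩ := h2
  exact ⟨m, n, hm.symm⟩

end G6
set_option linter.unusedSimpArgs false
namespace G6

/-- the central element -/
noncomputable def z : R6 := ι (t zv)
/-- two-fold screw -/
noncomputable def g : R6 := ι (t xv) * (a * a)
/-- four-fold screw -/
noncomputable def b : R6 := ι (t xv) * a
/-- an involution -/
noncomputable def u : R6 := ι (t ![-1, 0, 0]) * (a * a)

lemma a_t (v : Fin 3 → ℤ) : a * ι (t v) = ι (t ![v 1, v 2 - v 0, v 2]) * a := by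
  rw [a_ι, α_t]

lemma a_t' (v : Fin 3 → ℤ) (x : R6) :
    a * (ι (t v) * x) = ι (t ![v 1, v 2 - v 0, v 2]) * (a * x) := by
  rw [← mul_assoc, a_t, mul_assoc]

lemma ιt_mul (v w : Fin 3 → ℤ) : ι (t v) * ι (t w) = ι (t (v + w)) := by
  rw [← map_mul, t_mul]

lemma ιt_mul' (v w : Fin 3 → ℤ) (x : R6) : ι (t v) * (ι (t w) * x) = ι (t (v + w)) * x := by
  rw [← mul_assoc, ιt_mul]

lemma a4' : a * (a * (a * a)) = 1 := by rw [← a4]; simp only [mul_assoc]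

lemma a4'' (x : R6) : a * (a * (a * (a * x))) = x := by
  conv_rhs => rw [← one_mul x, ← a4]
  simp only [mul_assoc]

lemma z_comm (x : R6) : x * z = z * x := by
  have ha : a * z = z * a := by
    rw [z, a_t]; congr 3
  have hs : ∀ s : S6, ι s * z = z * ι s := fun s => by
    rw [z, ← map_mul, ← map_mul, mul_comm]
  have h2 : a * a * z = z * (a * a) := by rw [mul_assoc, ha, ← mul_assoc, ha, mul_assoc]
  have h3 : a * a * a * z = z * (a * a * a) := by rw [mul_assoc, ha, ← mul_assoc, h2, mul_assoc]
  obtain ⟨s0, s1, s2, s3, rfl⟩ := decomp x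
  simp only [add_mul, mul_add, hs]
  rw [mul_assoc, ha, mul_assoc, h2, mul_assoc, h3]
  simp only [← mul_assoc, hs]

lemma g_g : g * g = z := by
  simp only [g, z, mul_assoc, a_t', ιt_mul', ιt_mul, a4', mul_one]
  congr 2; decide

lemma b_a : b * a = g := by simp only [b, g, mul_assoc]

lemma u_u : u * u = 1 := by
  simp only [u, mul_assoc, a_t', ιt_mul', ιt_mul, a4', mul_one]
  rw [← map_one ι, ← t_zero]
  congr 2; decide

lemma b_b : b * b = z * u := by
  simp only [b, z, u, mul_assoc, a_t', ιt_mul']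
  congr 3; decide

lemma b_u : b * u = u * b := by
  simp only [b, u, mul_assoc, a_t', ιt_mul']
  congr 3; decide

/-- commutation rules pushing `z` then `u` to the left -/
lemma z_comm_left (x y : R6) : x * (z * y) = z * (x * y) := by
  rw [← mul_assoc, z_comm, mul_assoc]
lemma g_g' (x : R6) : g * (g * x) = z * x := by rw [← mul_assoc, g_g]
lemma b_a' (x : R6) : b * (a * x) = g * x := by rw [← mul_assoc, b_a]
lemma u_u' (x : R6) : u * (u * x) = x := by rw [← mul_assoc, u_u, one_mul]
lemma b_b' (x : R6) : b * (b * x) = z * (u * x) := by rw [← mul_assoc, b_b, mul_assoc]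
lemma b_u' (x : R6) : b * (u * x) = u * (b * x) := by rw [← mul_assoc, b_u, mul_assoc]

lemma b_g : b * g = z * (u * a) := by rw [← b_a, b_b']
lemma b_g' (x : R6) : b * (g * x) = z * (u * (a * x)) := by
  rw [← mul_assoc, b_g, mul_assoc, mul_assoc]

lemma a_g : a * g = u * b := by
  simp only [b, g, u, mul_assoc, a_t', ιt_mul']
  congr 3; decide
lemma a_g' (x : R6) : a * (g * x) = u * (b * x) := by
  rw [← mul_assoc, a_g, mul_assoc]

lemma a_z : a * z = z * a := z_comm a
lemma g_z : g * z = z * g := z_comm g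
lemma b_z : b * z = z * b := z_comm b
lemma u_z : u * z = z * u := z_comm u
lemma a_z' (x : R6) : a * (z * x) = z * (a * x) := z_comm_left _ _
lemma g_z' (x : R6) : g * (z * x) = z * (g * x) := z_comm_left _ _
lemma b_z' (x : R6) : b * (z * x) = z * (b * x) := z_comm_left _ _
lemma u_z' (x : R6) : u * (z * x) = z * (u * x) := z_comm_left _ _

/-- norm of `a` -/
noncomputable def N : R6 := 1 + a + a * a + a * a * a
/-- norm of `b` -/
noncomputable def Nb : R6 := 1 + b + b * b + b * b * b
/-- auxiliary -/
noncomputable def W : R6 := -(1 + z) + (1 + b) * (g - b)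
/-- edge part of the boundary of the face -/
noncomputable def E : R6 := Nb + W * (g + 1)
/-- vertex part of the boundary of the face -/
noncomputable def V : R6 := - (z * b * (1 + b) * (u + 1))

lemma N_a : N * (a - 1) = 0 := by
  simp only [N, mul_sub, add_mul, mul_one, one_mul, a4]; abel

lemma a_N : (a - 1) * N = 0 := by
  simp only [N, mul_add, sub_mul, mul_one, one_mul, mul_assoc, a4']; abel

lemma g_sq : (g + 1) * (g - 1) = z - 1 := by
  simp only [mul_sub, add_mul, mul_one, one_mul, g_g]; abel

lemma b_Nb : (b - 1) * Nb = z * z - 1 := by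
  simp only [Nb, mul_add, sub_mul, mul_sub, add_mul, mul_one, one_mul, mul_assoc, a_z, g_z, b_z, u_z, a_z', g_z', b_z', u_z', g_g, b_a, u_u, b_b, b_u,
    g_g', b_a', u_u', b_b', b_u']
  abel

lemma dd_q : (z - 1) * (a - 1) + -((a - 1) * (g + 1)) * (g - 1) = 0 := by
  rw [neg_mul, mul_assoc, g_sq]
  simp only [mul_sub, sub_mul, mul_one, one_mul, a_z]; abel

lemma dd_f : V * (a - 1) + E * (g - 1) = 0 := by
  simp only [V, E, W, Nb, mul_add, sub_mul, mul_sub, add_mul, mul_one, one_mul, mul_assoc, a_z, g_z, b_z, u_z, a_z', g_z', b_z', u_z', g_g, b_a, u_u, b_b, b_u,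
    a_g, a_g', b_g, b_g', g_g', b_a', u_u', b_b', b_u', neg_mul, mul_neg, neg_add]
  abel

lemma dd_f3V : (u - 1) * V = 0 := by
  simp only [V, mul_add, sub_mul, mul_sub, add_mul, mul_one, one_mul, mul_assoc, a_z, g_z, b_z, u_z, a_z', g_z', b_z', u_z', g_g, b_a, u_u, b_b, b_u,
    a_g, a_g', b_g, b_g', g_g', b_a', u_u', b_b', b_u', neg_mul, mul_neg, neg_add]
  abel

lemma dd_f3E : (u - 1) * E = 0 := by
  simp only [E, W, Nb, mul_add, sub_mul, mul_sub, add_mul, mul_one, one_mul, mul_assoc, a_z, g_z, b_z, u_z, a_z', g_z', b_z', u_z', g_g, b_a, u_u, b_b, b_u,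
    a_g, a_g', b_g, b_g', g_g', b_a', u_u', b_b', b_u', neg_mul, mul_neg, neg_add]
  abel

lemma dd_h3V : z * b * (u + 1) * (z - 1) + (b - 1) * V = 0 := by
  simp only [V, mul_add, sub_mul, mul_sub, add_mul, mul_one, one_mul, mul_assoc, a_z, g_z, b_z, u_z, a_z', g_z', b_z', u_z', g_g, b_a, u_u, b_b, b_u,
    a_g, a_g', b_g, b_g', g_g', b_a', u_u', b_b', b_u', neg_mul, mul_neg, neg_add]
  abel

lemma dd_h3E : z * b * (u + 1) * (-((a - 1) * (g + 1))) + (b - 1) * E = 0 := by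
  simp only [E, W, Nb, mul_add, sub_mul, mul_sub, add_mul, mul_one, one_mul, mul_assoc, a_z, g_z, b_z, u_z, a_z', g_z', b_z', u_z', g_g, b_a, u_u, b_b, b_u,
    a_g, a_g', b_g, b_g', g_g', b_a', u_u', b_b', b_u', neg_mul, mul_neg, neg_add]
  abel

end G6
/-- augmentation of an integral group ring -/
noncomputable def aug (G : Type) [Group G] : MonoidAlgebra ℤ G →+* ℤ :=
  (MonoidAlgebra.lift ℤ ℤ G 1).toRingHom

lemma aug_single {G : Type} [Group G] (x : G) (n : ℤ) : aug G (MonoidAlgebra.single x n) = n := by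
  have := MonoidAlgebra.lift_single (R := ℤ) (A := ℤ) (1 : G →* ℤ) x n
  exact this.trans (by simp)

namespace G6

lemma ι_inj_N {s : S6} (h : ι s * N = 0) : s = 0 := by
  have : ι s + ι s * a + ι s * (a * a) + ι s * (a * a * a) = 0 := by
    rw [← h, N]; simp only [mul_add, mul_one]
  exact (indep this).1

lemma reg {s : S6} (hs : s ≠ 0) {x : R6} (h : ι s * x = 0) : x = 0 := by
  obtain ⟨s0, s1, s2, s3, rfl⟩ := decomp x
  simp only [mul_add, ← mul_assoc, ← map_mul] at h
  simp only [mul_assoc] at h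
  simp only [← mul_assoc a a a] at h
  obtain ⟨h0, h1, h2, h3⟩ := indep h
  simp only [mul_eq_zero, hs, false_or] at h0 h1 h2 h3
  simp [h0, h1, h2, h3]

lemma z_reg {x : R6} (h : x * (z - 1) = 0) : x = 0 := by
  apply reg (t_ne zv (by decide))
  rw [map_sub, map_one, ← z, sub_mul, one_mul, ← z_comm]
  rwa [mul_sub, mul_one] at h

lemma zz_reg {x : R6} (h : x * (z * z - 1) = 0) : x = 0 := by
  apply reg (t_ne (zv + zv) (by decide))
  rw [map_sub, map_one, ← t_mul, map_mul, ← z, sub_mul, one_mul, mul_assoc, ← z_comm, ← z_comm,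
    mul_assoc]
  rwa [mul_sub, mul_one] at h

lemma g_reg {x : R6} (h : x * (g + 1) = 0) : x = 0 := by
  apply z_reg
  rw [← g_sq, ← mul_assoc, h, zero_mul]

lemma b_reg {x : R6} (h : x * (b - 1) = 0) : x = 0 := by
  apply zz_reg
  rw [← b_Nb, ← mul_assoc, h, zero_mul]

lemma aex1 {x : R6} (h : x * (a - 1) = 0) : ∃ y, x = y * N := by
  obtain ⟨s0, s1, s2, s3, rfl⟩ := decomp x
  have h' : ι (s3 - s0) + ι (s0 - s1) * a + ι (s1 - s2) * (a * a) + ι (s2 - s3) * (a * a * a)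
      = 0 := by
    rw [← h]
    simp only [map_sub, mul_sub, add_mul, mul_assoc, sub_mul, a4', mul_one]
    abel
  obtain ⟨h0, h1, h2, h3⟩ := indep h'
  rw [sub_eq_zero] at h0 h1 h2 h3
  subst h1 h2 h3
  exact ⟨ι s0, by simp only [N, mul_add, mul_one]⟩

lemma aN : a * N = N := by
  have := a_N
  rwa [sub_mul, one_mul, sub_eq_zero] at this

lemma mulN (x : R6) : ∃ s : S6, x * N = ι s * N := by
  obtain ⟨s0, s1, s2, s3, rfl⟩ := decomp x
  refine ⟨s0 + s1 + s2 + s3, ?_⟩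
  simp only [map_add, add_mul, mul_assoc, aN]

lemma aex2 {x : R6} (h : x * N = 0) : ∃ y, x = y * (a - 1) := by
  obtain ⟨s0, s1, s2, s3, rfl⟩ := decomp x
  have h' : ι (s0 + s1 + s2 + s3) * N = 0 := by
    rw [← h]
    simp only [map_add, add_mul, mul_assoc, aN]
  have h0 := ι_inj_N h'
  have h1 : s0 = -(s1 + s2 + s3) := by linear_combination h0
  refine ⟨ι s1 + ι s2 * (a + 1) + ι s3 * (a * a + a + 1), ?_⟩
  rw [h1]
  simp only [map_add, map_neg, mul_add, mul_sub, add_mul, mul_assoc, mul_one, one_mul]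
  abel

lemma decompG (v : Fin 3 → ℤ) (x : R6) : ∃ s0 s1 s2 s3 : S6,
    x = (ι s0 + ι s1 * a) + (ι s2 + ι s3 * a) * (ι (t v) * (a * a)) := by
  obtain ⟨s0, s1, s2, s3, rfl⟩ := decomp x
  refine ⟨s0, s1, s2 * t (-v), s3 * t (-![v 1, v 2 - v 0, v 2]), ?_⟩
  have e : ∀ w, ι (t (-w)) * ι (t w) = 1 := fun w => by
    rw [ιt_mul, neg_add_cancel, t_zero, map_one]
  have e' : ∀ (w) (x : R6), ι (t (-w)) * (ι (t w) * x) = x := fun w x => by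
    rw [← mul_assoc, e, one_mul]
  simp only [map_mul, add_mul, mul_assoc, a_t', e']
  abel

lemma indepG (v : Fin 3 → ℤ) {s0 s1 s2 s3 : S6}
    (h : (ι s0 + ι s1 * a) + (ι s2 + ι s3 * a) * (ι (t v) * (a * a)) = 0) :
    s0 = 0 ∧ s1 = 0 ∧ s2 = 0 ∧ s3 = 0 := by
  have hu : ∀ (w) (s : S6), s * t w = 0 → s = 0 := fun w s h => by
    have e : t w * t (-w) = 1 := by rw [t_mul, add_neg_cancel, t_zero]
    rw [← mul_one s, ← e, ← mul_assoc, h, zero_mul]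
  have h' : ι s0 + ι s1 * a + ι (s2 * t v) * (a * a) +
      ι (s3 * t ![v 1, v 2 - v 0, v 2]) * (a * a * a) = 0 := by
    rw [← h]
    simp only [map_mul, add_mul, mul_assoc, a_t']
    abel
  obtain ⟨h0, h1, h2, h3⟩ := indep h'
  exact ⟨h0, h1, hu _ _ h2, hu _ _ h3⟩

lemma uex1 {x : R6} (h : x * (u - 1) = 0) : ∃ y, x = y * (u + 1) := by
  obtain ⟨s0, s1, s2, s3, rfl⟩ := decompG ![-1, 0, 0] x
  rw [← u] at h ⊢
  have h' : (ι (s2 - s0) + ι (s3 - s1) * a) + (ι (s0 - s2) + ι (s1 - s3) * a) *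
      (ι (t ![-1, 0, 0]) * (a * a)) = 0 := by
    rw [← u, ← h]
    simp only [map_sub, mul_sub, sub_mul, add_mul, mul_assoc, u_u, mul_one]
    abel
  obtain ⟨h0, h1, -, -⟩ := indepG _ h'
  rw [sub_eq_zero] at h0 h1
  subst h0 h1
  exact ⟨ι s2 + ι s3 * a, by rw [mul_add, mul_one, add_comm]⟩

lemma uex2 {x : R6} (h : x * (u + 1) = 0) : ∃ y, x = y * (u - 1) := by
  obtain ⟨s0, s1, s2, s3, rfl⟩ := decompG ![-1, 0, 0] x
  rw [← u] at h ⊢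
  have h' : (ι (s2 + s0) + ι (s3 + s1) * a) + (ι (s0 + s2) + ι (s1 + s3) * a) *
      (ι (t ![-1, 0, 0]) * (a * a)) = 0 := by
    rw [← u, ← h]
    simp only [map_add, mul_add, add_mul, mul_assoc, u_u, mul_one]
    abel
  obtain ⟨-, -, h0, h1⟩ := indepG _ h'
  rw [add_eq_zero_iff_eq_neg] at h0 h1
  subst h0 h1
  refine ⟨ι s2 + ι s3 * a, ?_⟩
  simp only [map_neg, mul_sub, mul_one, neg_mul]; abel

lemma uu1 : (u - 1) * (u + 1) = 0 := by
  simp only [mul_add, sub_mul, u_u, mul_one, one_mul]; abel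
lemma uu2 : (u + 1) * (u - 1) = 0 := by
  simp only [mul_sub, add_mul, u_u, mul_one, one_mul]; abel
lemma bu1 : (b - 1) * (u + 1) = (u + 1) * (b - 1) := by
  simp only [mul_sub, sub_mul, mul_add, add_mul, b_u, mul_one, one_mul]; abel
lemma bu2 : (b - 1) * (u - 1) = (u - 1) * (b - 1) := by
  simp only [mul_sub, sub_mul, b_u, mul_one, one_mul]; abel

lemma K3 {s w : R6} (h : s * (u - 1) + w * (b - 1) = 0) : ∃ y, w = y * (u - 1) := by
  apply uex2
  apply b_reg
  have h2 : w * (b - 1) = - (s * (u - 1)) := by rw [eq_neg_iff_add_eq_zero, add_comm, h]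
  rw [mul_assoc, ← bu1, ← mul_assoc, h2, neg_mul, mul_assoc, uu1, mul_zero, neg_zero]

lemma zA {w r : R6} (h : w * (z - 1) = r * (a - 1)) : ∃ y, w = y * (a - 1) := by
  apply aex2
  apply z_reg
  have : N * (z - 1) = (z - 1) * N := by
    rw [mul_sub, z_comm, sub_mul, mul_one, one_mul]
  rw [mul_assoc, this, ← mul_assoc, h, mul_assoc, a_N, mul_zero]

lemma b_X : b = ι (t xv) * a := rfl

lemma Nb_red : ∃ r, Nb = (1 - ι (t yv)) + (ι (t xv) - 1) * a + r * (g + 1) := by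
  have h2 : b * b = ι (t yv) * g := by
    simp only [b, g, mul_assoc, a_t', ιt_mul']
    congr 3; decide
  have h3 : b * b * b = z * (a * g) := by
    rw [a_g, b_b, mul_assoc]
  have hz : z = 1 + (g + 1) * (g - 1) := by rw [g_sq]; abel
  refine ⟨ι (t yv) + z * a - a * (g - 1), ?_⟩
  have e1 : a * (g - 1) * (g + 1) = z * a - a := by
    rw [mul_assoc]
    have : (g - 1) * (g + 1) = z - 1 := by
      simp only [sub_mul, mul_add, mul_one, one_mul, g_g]; abel
    rw [this, mul_sub, mul_one, a_z]
  rw [Nb, h3, h2, sub_mul _ _ (g + 1), e1, b_X]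
  simp only [add_mul, mul_add, sub_mul, mul_one, one_mul, mul_assoc]
  abel

lemma g_sq' : (g - 1) * (g + 1) = z - 1 := by
  simp only [sub_mul, mul_add, mul_one, one_mul, g_g]; abel

lemma K1' {y r : R6} (h : y * (g - 1) = r * (a - 1)) : ∃ k w, y = k * Nb + w * (g + 1) := by
  obtain ⟨s0, s1, s2, s3, hy⟩ := decompG xv y
  rw [← g] at hy
  obtain ⟨ω, hω⟩ := mulN (ι s2 + ι s3 * a)
  have hy2 : y = ι (s0 - s2) + ι (s1 - s3) * a + (ι s2 + ι s3 * a) * (g + 1) := by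
    rw [hy]; simp only [map_sub, sub_mul, mul_add, mul_one]; abel
  have hN : y * (g - 1) * N = 0 := by rw [h, mul_assoc, a_N, mul_zero]
  have hgN : g * N = ι (t xv) * N := by simp only [g, mul_assoc, aN]
  have haX : a * (ι (t xv) * N) = ι (t yv) * N := by
    rw [a_t', aN]; congr 3
  have hzN : z * N = ι (t zv) * N := rfl
  have key : ι ((s0 - s2) * (t xv - 1) + (s1 - s3) * (t yv - 1) + ω * (t zv - 1)) * N = 0 := by
    rw [← hN, hy2]
    rw [add_mul _ _ (g - 1), mul_assoc _ (g + 1), g_sq]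
    have e3 : (ι s2 + ι s3 * a) * (z - 1) * N = ι (ω * (t zv - 1)) * N := by
      rw [mul_comm ω, map_mul, mul_assoc (ι (t zv - 1)) _ N, ← hω, map_sub, map_one, ← z, mul_sub, z_comm,
        mul_one, sub_mul, sub_mul, one_mul, mul_assoc]
    rw [add_mul _ _ N, e3, map_add, add_mul]
    congr 1
    simp only [map_add, map_mul, map_sub, map_one, mul_sub, add_mul, sub_mul, mul_assoc, hgN, haX,
      aN, mul_one]
    abel
  have key2 := ι_inj_N key
  obtain ⟨m, n, hmn⟩ := S3 (s0 - s2) (-ω) (-(s1 - s3)) (by linear_combination key2)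
  obtain ⟨q, hq⟩ := S2 (s1 - s3 + n * (t xv - 1)) (-(ω + m * (t xv - 1))) (by
    rw [hmn] at key2; linear_combination key2)
  have hq' : s1 - s3 = q * (t zv - 1) - n * (t xv - 1) := by linear_combination hq
  obtain ⟨r', hr'⟩ := Nb_red
  refine ⟨-ι n, ι n * r' + (ι m + ι q * a) * (g - 1) + (ι s2 + ι s3 * a), ?_⟩
  rw [hy2, hr', hmn, hq', add_mul (_ + _) _ (g + 1), add_mul _ (_ * (g - 1)) (g + 1), mul_assoc _ (g - 1), g_sq']
  have hz : ι (t zv) = z := rfl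
  simp only [map_add, map_mul, map_sub, map_one, hz]
  have : a * (z - 1) = (z - 1) * a := by rw [mul_sub, a_z, sub_mul, mul_one, one_mul]
  rw [add_mul _ _ (z - 1), mul_assoc _ a, this]
  generalize (g + 1) = G
  noncomm_ring

lemma K1 {x y : R6} (h : x * (a - 1) + y * (g - 1) = 0) :
    ∃ k w, y = k * E + w * ((a - 1) * (g + 1)) := by
  obtain ⟨k, w, hy⟩ := K1' (y := y) (r := -x) (by
    rw [neg_mul, eq_neg_iff_add_eq_zero, add_comm, h])
  have hy2 : y = k * E + (w - k * W) * (g + 1) := by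
    rw [hy, E]; generalize (g + 1) = G; noncomm_ring
  have hE : E * (g - 1) = - V * (a - 1) := by
    rw [neg_mul, eq_neg_iff_add_eq_zero, add_comm, dd_f]
  obtain ⟨y', hy'⟩ := zA (w := w - k * W) (r := -x + k * V) (by
    rw [← g_sq, ← mul_assoc]
    have : (w - k * W) * (g + 1) = y - k * E := by rw [hy2]; abel
    have h3 : y * (g - 1) = - (x * (a - 1)) := by rw [eq_neg_iff_add_eq_zero, add_comm, h]
    rw [this, sub_mul, mul_assoc, hE, h3, add_mul, neg_mul, neg_mul, mul_neg, mul_assoc]; abel)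
  exact ⟨k, y', by rw [← mul_assoc, ← hy', ← hy2]⟩

lemma mod_b (x : R6) : ∃ s q, x = ι s + q * (b - 1) := by
  have e : a = ι (t (-xv)) * b := by
    rw [b_X, ιt_mul', neg_add_cancel, t_zero, map_one, one_mul]
  have ha : ∀ x : R6, (∃ s q, x = ι s + q * (b - 1)) → ∃ s q, a * x = ι s + q * (b - 1) := by
    rintro x ⟨s, q, rfl⟩
    refine ⟨α s * t (-xv), ι (α s * t (-xv)) + a * q, ?_⟩
    rw [mul_add, a_ι, add_mul, ← mul_assoc a q]
    have e2 : ι (α s) * a = ι (α s * t (-xv)) * b := by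
      rw [map_mul, mul_assoc, ← e]
    rw [e2, mul_sub (ι _) b, mul_one, mul_assoc]
    abel
  have hι : ∀ (σ : S6) (x : R6), (∃ s q, x = ι s + q * (b - 1)) →
      ∃ s q, ι σ * x = ι s + q * (b - 1) := by
    rintro σ x ⟨s, q, rfl⟩
    exact ⟨σ * s, ι σ * q, by rw [mul_add, map_mul, mul_assoc]⟩
  have hadd : ∀ (x y : R6), (∃ s q, x = ι s + q * (b - 1)) → (∃ s q, y = ι s + q * (b - 1)) →
      ∃ s q, x + y = ι s + q * (b - 1) := by
    rintro x y ⟨s, q, rfl⟩ ⟨s', q', rfl⟩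
    exact ⟨s + s', q + q', by rw [map_add, add_mul]; abel⟩
  have h1 : ∃ s q, (1 : R6) = ι s + q * (b - 1) := ⟨1, 0, by simp⟩
  obtain ⟨s0, s1, s2, s3, rfl⟩ := decomp x
  have ha1 := ha _ h1
  have ha2 := ha _ ha1
  have ha3 := ha _ ha2
  rw [mul_one] at ha1 ha2 ha3
  rw [← mul_assoc] at ha3
  refine hadd _ _ (hadd _ _ (hadd _ _ ?_ (hι _ _ ha1)) (hι _ _ ha2)) (hι _ _ ha3)
  simpa using hι s0 _ h1

lemma K2' {s r : R6} (h : s * Nb = r * (g + 1)) : ∃ p q, s = p * (u - 1) + q * (b - 1) := by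
  obtain ⟨s', q, rfl⟩ := mod_b s
  obtain ⟨r', hr'⟩ := Nb_red
  have hzz : z * z - 1 = (z + 1) * (g - 1) * (g + 1) := by
    rw [mul_assoc, g_sq']; simp only [mul_sub, add_mul, mul_one, one_mul]; abel
  have h1 : ι s' * ((1 - ι (t yv)) + (ι (t xv) - 1) * a) =
      (r - ι s' * r' - q * ((z + 1) * (g - 1))) * (g + 1) := by
    have h2 : ι s' * Nb = r * (g + 1) - q * (z * z - 1) := by
      rw [← h, add_mul, mul_assoc, b_Nb]; abel
    rw [hr', mul_add _ _ (r' * (g + 1)), hzz, ← eq_sub_iff_add_eq] at h2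
    rw [h2]; simp only [sub_mul _ _ (g + 1), mul_assoc]; abel
  obtain ⟨m0, m1, n0, n1, hr⟩ := decompG xv (r - ι s' * r' - q * ((z + 1) * (g - 1)))
  rw [hr, ← g] at h1
  have h3 : (ι (m0 + n0 * t zv - s' * (1 - t yv)) + ι (m1 + n1 * t zv - s' * (t xv - 1)) * a) +
      (ι (m0 + n0) + ι (m1 + n1) * a) * (ι (t xv) * (a * a)) = 0 := by
    rw [← g]
    rw [eq_comm, ← sub_eq_zero] at h1
    rw [← h1]
    have hs : ∀ σ, ι (σ * t zv) = ι σ * z := fun σ => by rw [map_mul, z]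
    simp only [map_add, map_sub, hs, map_mul, map_one, mul_add, add_mul, mul_sub, sub_mul, mul_one,
      one_mul, mul_assoc, g_g, a_z]
    abel
  obtain ⟨h4, -, h5, -⟩ := indepG _ h3
  obtain ⟨m, hm⟩ := S2 s' (-n0) (by linear_combination h4 - h5)
  refine ⟨ι m * (b * b), ι m * (b + 1) + q, ?_⟩
  have hz : z - 1 = b * b * (u - 1) + (b + 1) * (b - 1) := by
    have : b * b * u = z := by rw [b_b, mul_assoc, u_u, mul_one]
    simp only [mul_sub, add_mul, this, mul_one, one_mul]; abel
  rw [hm, map_mul, map_sub, map_one, ← z, hz, add_mul (ι m * (b + 1)), mul_add]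
  simp only [mul_assoc]; abel

lemma mod_aug (x : R6) : ∃ p q, x - ((aug Gamma6 x : ℤ) : R6) = p * (a - 1) + q * (g - 1) := by
  suffices h : ∀ x : R6, x - ((aug Gamma6 x : ℤ) : R6) ∈ Submodule.span R6 {a - 1, g - 1} by
    obtain ⟨p, q, h⟩ := Submodule.mem_span_pair.1 (h x)
    exact ⟨p, q, h.symm⟩
  set I := Submodule.span R6 {a - 1, g - 1} with hI
  have ha : a - 1 ∈ I := Submodule.subset_span (by simp)
  have hg : g - 1 ∈ I := Submodule.subset_span (by simp)
  have hmul : ∀ x y : R6, x - 1 ∈ I → y - 1 ∈ I → x * y - 1 ∈ I := fun x y hx hy => by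
    have : x * y - 1 = x • (y - 1) + (x - 1) := by simp [mul_sub]
    rw [this]; exact I.add_mem (I.smul_mem _ hy) hx
  have hinv : ∀ x y : R6, y * x = 1 → x - 1 ∈ I → y - 1 ∈ I := fun x y h hx => by
    have : y - 1 = (-y) • (x - 1) := by
      rw [smul_eq_mul, neg_mul, mul_sub, h, mul_one]; abel
    rw [this]; exact I.smul_mem _ hx
  have ha2 := hmul _ _ ha ha
  have ha3 := hmul _ _ ha2 ha
  have hX : ι (t xv) - 1 ∈ I := by
    have : ι (t xv) = g * (a * a) := by simp only [g, mul_assoc, a4', mul_one]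
    rw [this]; exact hmul _ _ hg ha2
  have hconj : ∀ v : Fin 3 → ℤ, ι (t v) - 1 ∈ I → ι (t ![v 1, v 2 - v 0, v 2]) - 1 ∈ I := by
    intro v hv
    have : ι (t ![v 1, v 2 - v 0, v 2]) = a * ι (t v) * (a * a * a) := by
      rw [a_t]; simp only [mul_assoc, a4', mul_one]
    rw [this]; exact hmul _ _ (hmul _ _ ha hv) ha3
  let L : AddSubgroup (Fin 3 → ℤ) :=
    { carrier := {v | ι (t v) - 1 ∈ I}
      zero_mem' := by simp [t_zero]
      add_mem' := fun {x y} hx hy => by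
        show ι (t (x + y)) - 1 ∈ I
        rw [← ιt_mul]; exact hmul _ _ hx hy
      neg_mem' := fun {x} hx => by
        refine hinv _ _ ?_ hx
        rw [ιt_mul, neg_add_cancel, t_zero, map_one] }
  have hLX : xv ∈ L := hX
  have hLY : yv ∈ L := by
    have := hconj _ hX
    have e : ![xv 1, xv 2 - xv 0, xv 2] = yv := by decide
    rwa [e] at this
  have hLZ : ![1, 1, 1] ∈ L := by
    have := hconj _ hLY
    have e : ![yv 1, yv 2 - yv 0, yv 2] = ![1, 1, 1] := by decide
    rwa [e] at this
  have hL : ∀ v, v ∈ L := by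
    intro v
    have : v = v 0 • ![1, 1, 1] + (v 1 - v 0) • yv + (v 2 - v 1) • xv := by
      ext i; fin_cases i <;> simp [xv, yv]
    rw [this]
    exact L.add_mem (L.add_mem (L.zsmul_mem hLZ _) (L.zsmul_mem hLY _)) (L.zsmul_mem hLX _)
  have hk : ∀ k : Multiplicative (ZMod 4),
      (MonoidAlgebra.single (SemidirectProduct.inr k) 1 : R6) - 1 ∈ I := by
    intro k
    obtain ⟨k, rfl⟩ := Multiplicative.ofAdd.surjective k
    have : k = 0 ∨ k = 1 ∨ k = 2 ∨ k = 3 := by revert k; decide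
    rcases this with rfl | rfl | rfl | rfl
    · simp [← MonoidAlgebra.one_def]
    · exact ha
    · rw [← a2]; exact ha2
    · rw [← a3]; exact ha3
  intro x
  induction x using MonoidAlgebra.induction_linear with
  | zero => simp
  | add x y hx hy =>
    have : x + y - ((aug Gamma6 (x + y) : ℤ) : R6) =
      (x - ((aug Gamma6 x : ℤ) : R6)) + (y - ((aug Gamma6 y : ℤ) : R6)) := by
      rw [map_add, Int.cast_add]; abel
    rw [this]; exact I.add_mem hx hy
  | single γ n =>
    have h1 : (MonoidAlgebra.single γ n : R6) - ((aug Gamma6 (MonoidAlgebra.single γ n) : ℤ) : R6)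
        = n • ((MonoidAlgebra.single γ 1 : R6) - 1) := by
      rw [aug_single, smul_sub]; simp
    rw [h1]
    refine zsmul_mem ?_ n
    have key : (MonoidAlgebra.single γ 1 : R6) = ι (t γ.left.toAdd) *
        MonoidAlgebra.single (SemidirectProduct.inr γ.right) 1 := by
      rw [t, ι_single, MonoidAlgebra.single_mul_single]
      simp [SemidirectProduct.inl_left_mul_inr_right]
    rw [key]
    exact hmul _ _ (hL _) (hk _)

/-- values of the augmentation -/
lemma aug_ιt (v) : aug Gamma6 (ι (t v)) = 1 := by rw [t, ι_single, aug_single]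
lemma aug_a : aug Gamma6 a = 1 := by rw [a, aug_single]
lemma aug_z : aug Gamma6 z = 1 := aug_ιt _
lemma aug_g : aug Gamma6 g = 1 := by simp [g, aug_ιt, aug_a]
lemma aug_b : aug Gamma6 b = 1 := by simp [b, aug_ιt, aug_a]
lemma aug_u : aug Gamma6 u = 1 := by simp [u, aug_ιt, aug_a]

end G6
namespace FreeRes

open CategoryTheory

variable {G : Type} [Group G]

lemma free_apply {n : ℕ} (x : G) (v : Fin n →₀ MonoidAlgebra ℤ G) (j : Fin n) :
    Representation.free ℤ G (Fin n) x v j = MonoidAlgebra.single x 1 * v j := by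
  induction v using Finsupp.induction_linear with
  | zero => simp
  | add v w hv hw => simp [mul_add, hv, hw]
  | single i m =>
    rw [Representation.finsupp_single]
    by_cases h : i = j
    · subst h
      simp only [Finsupp.single_eq_same]
      induction m using MonoidAlgebra.induction_linear with
      | zero => simp
      | add v w hv hw => simp [mul_add, hv, hw]
      | single y k => simp [MonoidAlgebra.single_mul_single]
    · simp [Finsupp.single_apply, h]

/-- rows of a matrix as elements of a free module -/
noncomputable def row {m n : ℕ} (M : Matrix (Fin m) (Fin n) (MonoidAlgebra ℤ G)) (i : Fin m) :
    Fin n →₀ MonoidAlgebra ℤ G := Finsupp.equivFunOnFinite.symm (M i)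

/-- the map of free modules given by a matrix -/
noncomputable def fm {m n : ℕ} (M : Matrix (Fin m) (Fin n) (MonoidAlgebra ℤ G)) :
    Rep.free ℤ G (Fin m) ⟶ Rep.free ℤ G (Fin n) :=
  Rep.freeLift ℤ G (Rep.free ℤ G (Fin n)) (row M)

lemma freeLift_apply {m : ℕ} {V : Type} [AddCommGroup V] (σ : Representation ℤ G V)
    (f : Fin m → V) (v : Fin m →₀ MonoidAlgebra ℤ G) :
    Representation.freeLift σ f v = ∑ i, σ.asAlgebraHom (v i) (f i) := by
  induction v using Finsupp.induction_linear with
  | zero => simp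
  | add v w hv hw => simp [Finset.sum_add_distrib, hv, hw]
  | single i x =>
    rw [Finset.sum_eq_single i]
    · simp only [Finsupp.single_eq_same]
      induction x using MonoidAlgebra.induction_linear with
      | zero => simp
      | add v w hv hw => simp [hv, hw]
      | single y k => rw [Representation.freeLift_single_single]; simp
    · intro j _ h
      simp [Finsupp.single_apply, h.symm]
    · simp

lemma free_alg {n : ℕ} (x : MonoidAlgebra ℤ G) (v : Fin n →₀ MonoidAlgebra ℤ G) (j : Fin n) :
    (Representation.free ℤ G (Fin n)).asAlgebraHom x v j = x * v j := by
  induction x using MonoidAlgebra.induction_linear with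
  | zero => simp
  | add v w hv hw => simp [add_mul, hv, hw]
  | single y k =>
    rw [Representation.asAlgebraHom_single, LinearMap.smul_apply, Finsupp.smul_apply, free_apply,
      ← smul_mul_assoc]
    simp

lemma fm_apply {m n : ℕ} (M : Matrix (Fin m) (Fin n) (MonoidAlgebra ℤ G))
    (v : Fin m →₀ MonoidAlgebra ℤ G) :
    ⇑((fm M).hom v : Fin n →₀ MonoidAlgebra ℤ G) = Matrix.vecMul (⇑v) M := by
  ext1 j
  have : (fm M).hom v = ∑ i, (Representation.free ℤ G (Fin n)).asAlgebraHom (v i) (row M i) :=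
    freeLift_apply _ _ _
  rw [this, Finsupp.finset_sum_apply]
  simp only [free_alg, Matrix.vecMul, dotProduct]
  rfl

/-- augmentation map -/
noncomputable def augm (m : ℕ) : Rep.free ℤ G (Fin m) ⟶ Rep.trivial ℤ G ℤ :=
  Rep.freeLift ℤ G (Rep.trivial ℤ G ℤ) (fun _ => 1)

lemma triv_alg (x : MonoidAlgebra ℤ G) (k : ℤ) :
    (Representation.trivial ℤ G ℤ).asAlgebraHom x k = aug G x * k := by
  induction x using MonoidAlgebra.induction_linear with
  | zero => simp
  | add v w hv hw => simp [add_mul, hv, hw]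
  | single y k => rw [aug_single]; simp

lemma lift_triv {m : ℕ} (f : Fin m → ℤ) (v : Fin m →₀ MonoidAlgebra ℤ G) :
    ((Rep.freeLift ℤ G (Rep.trivial ℤ G ℤ) f).hom v : ℤ) = ∑ i, aug G (v i) * f i := by
  have : (Rep.freeLift ℤ G (Rep.trivial ℤ G ℤ) f).hom v =
    ∑ i, (Representation.trivial ℤ G ℤ).asAlgebraHom (v i) (f i) := freeLift_apply _ _ _
  rw [this]
  simp only [triv_alg]

lemma fm_comp {l m n : ℕ} (M : Matrix (Fin l) (Fin m) (MonoidAlgebra ℤ G))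
    (M' : Matrix (Fin m) (Fin n) (MonoidAlgebra ℤ G)) (h : M * M' = 0) : fm M ≫ fm M' = 0 := by
  apply Rep.hom_ext
  refine DFunLike.ext _ _ fun v => ?_
  apply DFunLike.coe_injective
  show ⇑((fm M').hom ((fm M).hom v)) = 0
  rw [fm_apply, fm_apply, Matrix.vecMul_vecMul, h, Matrix.vecMul_zero]

end FreeRes
namespace FreeRes

open CategoryTheory

variable {G : Type} [Group G]

/-- Data of a free resolution given by matrices -/
structure Data (G : Type) [Group G] where
  /-- ranks -/
  r : ℕ → ℕ
  /-- differentials -/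
  D : ∀ n, Matrix (Fin (r (n + 1))) (Fin (r n)) (MonoidAlgebra ℤ G)
  sq : ∀ n, D (n + 1) * D n = 0
  ex : ∀ n v, Matrix.vecMul v (D n) = 0 → ∃ w, v = Matrix.vecMul w (D (n + 1))
  aug0 : ∀ w, ∑ i, aug G (Matrix.vecMul w (D 0) i) = 0
  exaug : ∀ v : Fin (r 0) → MonoidAlgebra ℤ G, ∑ i, aug G (v i) = 0 → ∃ w, v = Matrix.vecMul w (D 0)
  pos : 0 < r 0

variable (P : Data G)

/-- the complex -/
noncomputable def cx : ChainComplex (Rep ℤ G) ℕ :=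
  ChainComplex.of (fun n => Rep.free ℤ G (Fin (P.r n))) (fun n => fm (P.D n))
    (fun n => fm_comp _ _ (P.sq n))

lemma cx_d (n : ℕ) : (cx P).d (n + 1) n = fm (P.D n) := by
  exact (ChainComplex.of_d (fun n => Rep.free ℤ G (Fin (P.r n))) (fun n => fm (P.D n)) n)

lemma aug_comp : (cx P).d 1 0 ≫ (augm (P.r 0) : Rep.free ℤ G (Fin (P.r 0)) ⟶ _) = 0 := by
  rw [cx_d]
  apply Rep.hom_ext
  refine DFunLike.ext _ _ fun (v : Fin (P.r 1) →₀ MonoidAlgebra ℤ G) => ?_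
  show (augm (P.r 0)).hom ((fm (P.D 0)).hom v) = (0 : ℤ)
  rw [augm]
  refine (lift_triv _ _).trans ?_
  have h := P.aug0 v
  rw [← fm_apply] at h
  simpa using! h

/-- augmentation as a map of complexes -/
noncomputable def pi : cx P ⟶ (ChainComplex.single₀ (Rep ℤ G)).obj (Rep.trivial ℤ G ℤ) :=
  ((cx P).toSingle₀Equiv _).symm ⟨augm (P.r 0), aug_comp P⟩

lemma pi_f : (pi P).f 0 = augm (P.r 0) := by
  exact ChainComplex.toSingle₀Equiv_symm_apply_f_zero _ _

lemma vec_lift {m n : ℕ} {M : Matrix (Fin m) (Fin n) (MonoidAlgebra ℤ G)}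
    {v : Fin n →₀ MonoidAlgebra ℤ G} (h : ∃ w, ⇑v = Matrix.vecMul w M) :
    ∃ w : Fin m →₀ MonoidAlgebra ℤ G, (fm M).hom w = v := by
  obtain ⟨w, hw⟩ := h
  refine ⟨Finsupp.equivFunOnFinite.symm w, ?_⟩
  apply DFunLike.coe_injective
  rw [fm_apply, hw]; rfl

lemma exact_of_elements {k : Type} [CommRing k] (S : ShortComplex (Rep.{0} k G))
    (h : ∀ x : S.X₂, S.g.hom x = 0 → ∃ y : S.X₁, S.f.hom y = x) : S.Exact := by
  apply (forget₂ (Rep.{0} k G) (ModuleCat.{0} k)).reflects_exact_of_faithful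
  rw [ShortComplex.moduleCat_exact_iff]
  exact h

lemma quasiIso : QuasiIso (pi P) where
  quasiIsoAt m := by
    cases m with
    | zero =>
      rw [ChainComplex.quasiIsoAt₀_iff, ShortComplex.quasiIso_iff_of_zeros' _ rfl rfl rfl]
      constructor
      · apply exact_of_elements
        intro (x : Fin (P.r 0) →₀ MonoidAlgebra ℤ G) hx
        have hx' : (augm (P.r 0)).hom x = (0 : ℤ) := by
          rw [← pi_f]; exact hx
        have h2 := (lift_triv (fun _ => 1) x).symm.trans hx'
        simp only [mul_one] at h2
        obtain ⟨y, hy⟩ := vec_lift (P.exaug _ h2)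
        refine ⟨y, ?_⟩
        rw [← hy, ← cx_d]; rfl
      · rw [Rep.epi_iff_surjective]
        intro (x : ℤ)
        refine ⟨(Finsupp.single ⟨0, P.pos⟩ (MonoidAlgebra.single 1 x) :
          Fin (P.r 0) →₀ MonoidAlgebra ℤ G), ?_⟩
        have : (augm (P.r 0)).hom (Finsupp.single ⟨0, P.pos⟩ (MonoidAlgebra.single 1 x) :
          Fin (P.r 0) →₀ MonoidAlgebra ℤ G) = x := by
          refine (lift_triv _ _).trans ?_
          rw [Finset.sum_eq_single ⟨0, P.pos⟩]
          · simp [aug_single]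
          · intro j _ h
            simp [h.symm]
          · simp
        rw [← pi_f] at this; exact this
    | succ m =>
      rw [quasiIsoAt_iff_exactAt' (hL := ChainComplex.exactAt_succ_single_obj ..),
          HomologicalComplex.exactAt_iff' _ (m + 2) (m + 1) m (by simp) (by simp)]
      apply exact_of_elements
      intro (x : Fin (P.r (m + 1)) →₀ MonoidAlgebra ℤ G) hx
      have hx' : (fm (P.D m)).hom x = 0 := by
        rw [← cx_d]; exact hx
      have h2 := fm_apply (P.D m) x
      rw [hx'] at h2
      obtain ⟨y, hy⟩ := vec_lift (P.ex m x h2.symm)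
      refine ⟨y, ?_⟩
      rw [← hy, ← cx_d]; rfl

/-- the projective resolution -/
noncomputable def res : ProjectiveResolution (Rep.trivial ℤ G ℤ) where
  complex := cx P
  projective n := inferInstanceAs <| Projective (Rep.free ℤ G (Fin (P.r n)))
  π := pi P
  quasiIso := quasiIso P

/-- computing homology of a short complex of modules -/
lemma sc_homology' {k : Type} [Ring k] (S : ShortComplex (ModuleCat.{0} k)) {H : Type}
    [AddCommGroup H] [Module k H]
    (φ : S.X₂ →ₗ[k] H) (hs : ∀ y, ∃ x, S.g x = 0 ∧ φ x = y)
    (hk : ∀ x, S.g x = 0 → (φ x = 0 ↔ ∃ w, S.f w = x)) : Nonempty (S.homology ≃+ H) := by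
  let ψ : LinearMap.ker S.g.hom →ₗ[k] H := φ.comp (LinearMap.ker S.g.hom).subtype
  have hψ : Function.Surjective ψ := fun y => by
    obtain ⟨x, hx, rfl⟩ := hs y
    exact ⟨⟨x, hx⟩, rfl⟩
  have hker : LinearMap.range S.moduleCatToCycles = LinearMap.ker ψ := by
    ext ⟨x, hx⟩
    rw [LinearMap.mem_ker, LinearMap.mem_range]
    have := hk x hx
    constructor
    · rintro ⟨w, hw⟩
      exact this.2 ⟨w, congrArg Subtype.val hw⟩
    · intro h
      obtain ⟨w, hw⟩ := this.1 h
      exact ⟨w, Subtype.ext hw⟩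
  exact ⟨(S.moduleCatHomologyIso.toLinearEquiv.trans
    ((Submodule.quotEquivOfEq _ _ hker).trans (ψ.quotKerEquivOfSurjective hψ))).toAddEquiv⟩

/-- computing homology of a short complex of abelian groups -/
lemma sc_homology (S : ShortComplex (ModuleCat.{0} ℤ)) {H : Type} [AddCommGroup H]
    (φ : S.X₂ →+ H) (hs : ∀ y, ∃ x, S.g x = 0 ∧ φ x = y)
    (hk : ∀ x, S.g x = 0 → (φ x = 0 ↔ ∃ w, S.f w = x)) : Nonempty (S.homology ≃+ H) :=
  sc_homology' S
    { toFun := φ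
      map_add' := fun x y => map_add φ _ _
      map_smul' := fun m x => map_intCast_smul φ ℤ ℤ m x } hs hk

/-- differentials of the dual complex -/
noncomputable def dual (n : ℕ) (f : Fin (P.r n) → ℤ) : Fin (P.r (n + 1)) → ℤ :=
  fun i => ∑ j, aug G (P.D n i j) * f j

/-- identification of dual modules -/
noncomputable def eqv (n : ℕ) : ((cx P).linearYonedaObj ℤ (Rep.trivial ℤ G ℤ)).X n ≃+
    (Fin (P.r n) → ℤ) :=
  (Rep.freeLiftLEquiv ℤ G (Fin (P.r n)) (Rep.trivial ℤ G ℤ)).toAddEquiv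

lemma eqv_d (n : ℕ) (f) : eqv P (n + 1) (((cx P).linearYonedaObj ℤ (Rep.trivial ℤ G ℤ)).d n (n + 1) f)
    = dual P n (eqv P n f) := by
  obtain ⟨f, rfl⟩ := (eqv P n).symm.surjective f
  rw [AddEquiv.apply_symm_apply]
  funext i
  have : (((cx P).linearYonedaObj ℤ (Rep.trivial ℤ G ℤ)).d n (n + 1) ((eqv P n).symm f)) =
    (fm (P.D n) ≫ Rep.freeLift ℤ G (Rep.trivial ℤ G ℤ) f : _ ⟶ Rep.trivial ℤ G ℤ) := by
    rw [← cx_d]; rfl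
  rw [this]
  show (Rep.freeLift ℤ G (Rep.trivial ℤ G ℤ) f).hom ((fm (P.D n)).hom
    (Finsupp.single i (MonoidAlgebra.single 1 1))) = _
  refine (lift_triv _ _).trans ?_
  rw [fm_apply, dual]
  refine Finset.sum_congr rfl fun j _ => ?_
  congr 2
  rw [Matrix.vecMul, dotProduct, Finset.sum_eq_single i]
  · simp [← MonoidAlgebra.one_def]
  · intro k _ h
    simp [h.symm]
  · simp

theorem cohomology_succ (n : ℕ) {H : Type} [AddCommGroup H] (φ : (Fin (P.r (n + 1)) → ℤ) →+ H)
    (hs : ∀ y, ∃ x, dual P (n + 1) x = 0 ∧ φ x = y)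
    (hk : ∀ x, dual P (n + 1) x = 0 → (φ x = 0 ↔ ∃ w, dual P n w = x)) :
    Nonempty (groupCohomology (Rep.trivial ℤ G ℤ) (n + 1) ≃+ H) := by
  let K := (cx P).linearYonedaObj ℤ (Rep.trivial ℤ G ℤ)
  have e1 := (groupCohomologyIso (Rep.trivial ℤ G ℤ) (n + 1) (res P)).toLinearEquiv.toAddEquiv
  have e2 := (ShortComplex.homologyMapIso (K.isoSc' n (n + 1) (n + 2) (by simp)
    (by simp))).toLinearEquiv.toAddEquiv
  have hz : ∀ x, K.d (n + 1) (n + 2) x = 0 ↔ dual P (n + 1) (eqv P _ x) = 0 := fun x => by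
    rw [← eqv_d, map_eq_zero_iff _ (eqv P _).injective]
  obtain ⟨e3⟩ := sc_homology (K.sc' n (n + 1) (n + 2)) (φ.comp (eqv P (n + 1)).toAddMonoidHom)
    (fun y => by
      obtain ⟨x, hx, rfl⟩ := hs y
      refine ⟨(eqv P _).symm x, ?_, ?_⟩
      · refine (hz _).2 ?_
        rw [AddEquiv.apply_symm_apply, hx]
      · exact congrArg φ ((eqv P _).apply_symm_apply x))
    (fun x hx => by
      refine (hk _ ((hz x).1 hx)).trans ?_
      constructor
      · rintro ⟨w, hw⟩
        refine ⟨(eqv P _).symm w, ?_⟩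
        apply (eqv P (n + 1)).injective
        refine (eqv_d P n _).trans ?_
        rw [AddEquiv.apply_symm_apply, hw]
      · rintro ⟨w, hw⟩
        refine ⟨eqv P _ w, ?_⟩
        exact (eqv_d P n w).symm.trans (congrArg (eqv P (n + 1)) hw))
  exact ⟨(e1.trans e2).trans e3⟩

theorem cohomology_zero {H : Type} [AddCommGroup H] (φ : (Fin (P.r 0) → ℤ) →+ H)
    (hs : ∀ y, ∃ x, dual P 0 x = 0 ∧ φ x = y)
    (hk : ∀ x, dual P 0 x = 0 → (φ x = 0 ↔ x = 0)) :
    Nonempty (groupCohomology (Rep.trivial ℤ G ℤ) 0 ≃+ H) := by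
  let K := (cx P).linearYonedaObj ℤ (Rep.trivial ℤ G ℤ)
  have e1 := (groupCohomologyIso (Rep.trivial ℤ G ℤ) 0 (res P)).toLinearEquiv.toAddEquiv
  have e2 := (ShortComplex.homologyMapIso (K.isoSc' 0 0 1 (by simp)
    (by simp))).toLinearEquiv.toAddEquiv
  have hz : ∀ x, K.d 0 1 x = 0 ↔ dual P 0 (eqv P _ x) = 0 := fun x => by
    rw [← eqv_d, map_eq_zero_iff _ (eqv P _).injective]
  have h0 : K.d 0 0 = 0 := K.shape _ _ (by simp)
  obtain ⟨e3⟩ := sc_homology (K.sc' 0 0 1) (φ.comp (eqv P 0).toAddMonoidHom)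
    (fun y => by
      obtain ⟨x, hx, rfl⟩ := hs y
      refine ⟨(eqv P _).symm x, ?_, ?_⟩
      · refine (hz _).2 ?_
        rw [AddEquiv.apply_symm_apply, hx]
      · exact congrArg φ ((eqv P _).apply_symm_apply x))
    (fun x hx => by
      refine (hk _ ((hz x).1 hx)).trans ?_
      refine (map_eq_zero_iff (eqv P 0) (eqv P 0).injective).trans ?_
      have h0' : ∀ w, (K.sc' 0 0 1).f w = 0 := fun w => by
        show K.d 0 0 w = 0
        rw [h0]; rfl
      constructor
      · intro h; exact ⟨0, by rw [h, map_zero]; rfl⟩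
      · rintro ⟨w, hw⟩
        rw [← hw]; exact h0' w)
  exact ⟨(e1.trans e2).trans e3⟩

end FreeRes
namespace G6

lemma N_z : N * (z - 1) = (z - 1) * N := by
  rw [mul_sub, z_comm, sub_mul, mul_one, one_mul]
lemma a1_z : (a - 1) * (z - 1) = (z - 1) * (a - 1) := by
  rw [mul_sub, z_comm, mul_one, sub_mul z 1, one_mul]
lemma zbu : z * b * (u + 1) = (u + 1) * (z * b) := by
  simp only [mul_add, add_mul, mul_assoc, b_u, u_z', mul_one, one_mul]

/-- differentials -/
noncomputable def D0 : Matrix (Fin 2) (Fin 1) R6 := !![a - 1; g - 1]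
/-- differentials -/
noncomputable def D1 : Matrix (Fin 3) (Fin 2) R6 :=
  !![N, 0; z - 1, -((a - 1) * (g + 1)); V, E]
/-- differentials -/
noncomputable def D2 : Matrix (Fin 4) (Fin 3) R6 :=
  !![a - 1, 0, 0; z - 1, -N, 0; 0, 0, u - 1; 0, z * b * (u + 1), b - 1]
/-- differentials -/
noncomputable def DA : Matrix (Fin 4) (Fin 4) R6 :=
  !![N, 0, 0, 0; z - 1, -(a - 1), 0, 0; 0, 0, u + 1, 0; 0, 0, b - 1, -(u - 1)]
/-- differentials -/
noncomputable def DB : Matrix (Fin 4) (Fin 4) R6 :=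
  !![a - 1, 0, 0, 0; z - 1, -N, 0, 0; 0, 0, u - 1, 0; 0, 0, b - 1, -(u + 1)]

lemma mem_D0 (v : Fin 2 → R6) : Matrix.vecMul v D0 = ![v 0 * (a - 1) + v 1 * (g - 1)] := by
  ext1 i; fin_cases i; simp [D0, Matrix.vecMul, dotProduct, Fin.sum_univ_succ]

lemma mem_D1 (v : Fin 3 → R6) : Matrix.vecMul v D1 =
    ![v 0 * N + v 1 * (z - 1) + v 2 * V, -(v 1 * ((a - 1) * (g + 1))) + v 2 * E] := by
  ext1 i; fin_cases i <;> simp [D1, Matrix.vecMul, dotProduct, Fin.sum_univ_succ, add_assoc]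

lemma mem_D2 (v : Fin 4 → R6) : Matrix.vecMul v D2 =
    ![v 0 * (a - 1) + v 1 * (z - 1), -(v 1 * N) + v 3 * (z * b * (u + 1)),
      v 2 * (u - 1) + v 3 * (b - 1)] := by
  ext1 i; fin_cases i <;> simp [D2, Matrix.vecMul, dotProduct, Fin.sum_univ_succ]

lemma mem_DA (v : Fin 4 → R6) : Matrix.vecMul v DA =
    ![v 0 * N + v 1 * (z - 1), -(v 1 * (a - 1)),
      v 2 * (u + 1) + v 3 * (b - 1), -(v 3 * (u - 1))] := by
  ext1 i; fin_cases i <;>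
    simp only [DA, Matrix.vecMul, dotProduct, Fin.sum_univ_succ, Fin.sum_univ_zero] <;> 
    simp [-neg_sub]

lemma mem_DB (v : Fin 4 → R6) : Matrix.vecMul v DB =
    ![v 0 * (a - 1) + v 1 * (z - 1), -(v 1 * N),
      v 2 * (u - 1) + v 3 * (b - 1), -(v 3 * (u + 1))] := by
  ext1 i; fin_cases i <;>
    simp only [DB, Matrix.vecMul, dotProduct, Fin.sum_univ_succ, Fin.sum_univ_zero] <;> 
    simp [-neg_sub, -neg_add_rev]

lemma ex_AB (v : Fin 4 → R6) (h : Matrix.vecMul v DA = 0) : ∃ w, v = Matrix.vecMul w DB := by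
  rw [mem_DA] at h
  have h0 : v 0 * N + v 1 * (z - 1) = 0 := congrFun h 0
  have h1 : -(v 1 * (a - 1)) = 0 := congrFun h 1
  have h2 : v 2 * (u + 1) + v 3 * (b - 1) = 0 := congrFun h 2
  have h3 : -(v 3 * (u - 1)) = 0 := congrFun h 3
  rw [neg_eq_zero] at h1 h3
  obtain ⟨y, hy⟩ := aex1 h1
  obtain ⟨w, hw⟩ := uex1 h3
  obtain ⟨p, hp⟩ := aex2 (x := v 0 + y * (z - 1)) (by
    rw [add_mul, mul_assoc, ← N_z, ← mul_assoc, ← hy, h0])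
  obtain ⟨f, hf⟩ := uex2 (x := v 2 + w * (b - 1)) (by
    rw [add_mul, mul_assoc, bu1, ← mul_assoc, ← hw, h2])
  refine ⟨![p, -y, f, -w], ?_⟩
  rw [mem_DB]
  ext1 i; fin_cases i
  · simp [← hp]
  · simp [hy]
  · simp [← hf]
  · simp [hw]

lemma ex_BA (v : Fin 4 → R6) (h : Matrix.vecMul v DB = 0) : ∃ w, v = Matrix.vecMul w DA := by
  rw [mem_DB] at h
  have h0 : v 0 * (a - 1) + v 1 * (z - 1) = 0 := congrFun h 0
  have h1 : -(v 1 * N) = 0 := congrFun h 1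
  have h2 : v 2 * (u - 1) + v 3 * (b - 1) = 0 := congrFun h 2
  have h3 : -(v 3 * (u + 1)) = 0 := congrFun h 3
  rw [neg_eq_zero] at h1 h3
  obtain ⟨y, hy⟩ := aex2 h1
  obtain ⟨w, hw⟩ := uex2 h3
  obtain ⟨p, hp⟩ := aex1 (x := v 0 + y * (z - 1)) (by
    rw [add_mul, mul_assoc, ← a1_z, ← mul_assoc, ← hy, h0])
  obtain ⟨f, hf⟩ := uex1 (x := v 2 + w * (b - 1)) (by
    rw [add_mul, mul_assoc, bu2, ← mul_assoc, ← hw, h2])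
  refine ⟨![p, -y, f, -w], ?_⟩
  rw [mem_DA]
  ext1 i; fin_cases i
  · simp [← hp]
  · simp [hy]
  · simp [← hf]
  · simp [hw]

lemma ex_2A (v : Fin 4 → R6) (h : Matrix.vecMul v D2 = 0) : ∃ w, v = Matrix.vecMul w DA := by
  rw [mem_D2] at h
  have h0 : v 0 * (a - 1) + v 1 * (z - 1) = 0 := congrFun h 0
  have h1 : -(v 1 * N) + v 3 * (z * b * (u + 1)) = 0 := congrFun h 1
  have h2 : v 2 * (u - 1) + v 3 * (b - 1) = 0 := congrFun h 2
  obtain ⟨w, hw⟩ := K3 h2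
  rw [hw, zbu, mul_assoc, ← mul_assoc (u - 1), uu1, zero_mul, mul_zero, add_zero, neg_eq_zero] at h1
  obtain ⟨y, hy⟩ := aex2 h1
  obtain ⟨p, hp⟩ := aex1 (x := v 0 + y * (z - 1)) (by
    rw [add_mul, mul_assoc, ← a1_z, ← mul_assoc, ← hy, h0])
  obtain ⟨f, hf⟩ := uex1 (x := v 2 + w * (b - 1)) (by
    rw [add_mul, mul_assoc, bu2, ← mul_assoc, ← hw, h2])
  refine ⟨![p, -y, f, -w], ?_⟩
  rw [mem_DA]
  ext1 i; fin_cases i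
  · simp [← hp]
  · simp [hy]
  · simp [← hf]
  · simp [hw]

lemma ex_12 (v : Fin 3 → R6) (h : Matrix.vecMul v D1 = 0) : ∃ w, v = Matrix.vecMul w D2 := by
  rw [mem_D1] at h
  have h0 : v 0 * N + v 1 * (z - 1) + v 2 * V = 0 := congrFun h 0
  have h1 : -(v 1 * ((a - 1) * (g + 1))) + v 2 * E = 0 := congrFun h 1
  obtain ⟨f, k, hs⟩ := K2' (s := v 2) (r := v 1 * (a - 1) - v 2 * W) (by
    rw [E, mul_add (v 2)] at h1
    rw [sub_mul, mul_assoc, mul_assoc, ← sub_eq_zero, ← h1]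
    abel)
  have hE : (b - 1) * E = z * b * (u + 1) * ((a - 1) * (g + 1)) := by
    have := dd_h3E
    rw [mul_neg, neg_add_eq_zero] at this
    exact this.symm
  have hV : (b - 1) * V = - (z * b * (u + 1) * (z - 1)) := by
    rw [eq_neg_iff_add_eq_zero, add_comm, dd_h3V]
  have h2 : (v 1 - k * (z * b * (u + 1))) * (a - 1) = 0 := by
    apply g_reg
    rw [hs, add_mul, mul_assoc, dd_f3E, mul_zero, zero_add, mul_assoc k, hE, neg_add_eq_zero] at h1
    rw [mul_assoc, sub_mul, h1, mul_assoc k, sub_self]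
  obtain ⟨y, hy⟩ := aex1 h2
  obtain ⟨p, hp⟩ := aex2 (x := v 0 + y * (z - 1)) (by
    rw [add_mul, mul_assoc, ← N_z, ← mul_assoc, ← hy, ← h0, hs, add_mul _ _ V, mul_assoc f,
      dd_f3V, mul_zero, mul_assoc k _ V, hV, sub_mul, mul_assoc k, mul_neg]
    abel)
  refine ⟨![p, -y, f, k], ?_⟩
  rw [mem_D2]
  ext1 i; fin_cases i
  · simp [← hp]
  · simp [← hy]
  · simp [hs]

lemma ex_01 (v : Fin 2 → R6) (h : Matrix.vecMul v D0 = 0) : ∃ w, v = Matrix.vecMul w D1 := by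
  rw [mem_D0] at h
  have h0 : v 0 * (a - 1) + v 1 * (g - 1) = 0 := congrFun h 0
  obtain ⟨k, w, hk⟩ := K1 h0
  have hE : E * (g - 1) = -(V * (a - 1)) := by
    rw [eq_neg_iff_add_eq_zero, add_comm, dd_f]
  obtain ⟨p, hp⟩ := aex1 (x := v 0 - k * V + w * (z - 1)) (by
    rw [← h0, hk, add_mul _ _ (g - 1), mul_assoc k, hE, mul_assoc w (_ * _), mul_assoc (a - 1),
      g_sq, a1_z, add_mul, sub_mul, mul_assoc k, mul_assoc w, mul_neg]
    abel)
  refine ⟨![p, -w, k], ?_⟩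
  rw [mem_D1]
  ext1 i; fin_cases i
  · simp [← hp]
  · simp [hk, add_comm]

lemma eq_zero_of_vecMul {m n : ℕ} {M : Matrix (Fin m) (Fin n) R6}
    (h : ∀ v, Matrix.vecMul v M = 0) : M = 0 := by
  refine Matrix.ext fun i j => ?_
  have := congrFun (h (Pi.single i 1)) j
  rw [Matrix.single_one_vecMul] at this; exact this

lemma sq_10 : D1 * D0 = 0 := by
  apply eq_zero_of_vecMul; intro v
  rw [← Matrix.vecMul_vecMul, mem_D1, mem_D0]
  ext1 i; fin_cases i
  have e1 := dd_q
  have e2 := dd_f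
  have e3 := N_a
  show (v 0 * N + v 1 * (z - 1) + v 2 * V) * (a - 1) +
    (-(v 1 * ((a - 1) * (g + 1))) + v 2 * E) * (g - 1) = 0
  have : (v 0 * N + v 1 * (z - 1) + v 2 * V) * (a - 1) +
    (-(v 1 * ((a - 1) * (g + 1))) + v 2 * E) * (g - 1) = v 0 * (N * (a - 1)) +
      v 1 * ((z - 1) * (a - 1) + -((a - 1) * (g + 1)) * (g - 1)) + 
      v 2 * (V * (a - 1) + E * (g - 1)) := by
    generalize a - 1 = A; generalize g - 1 = B; generalize g + 1 = C; generalize z - 1 = Z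
    noncomm_ring
  rw [this, e1, e2, e3]; simp

lemma sq_21 : D2 * D1 = 0 := by
  apply eq_zero_of_vecMul; intro v
  rw [← Matrix.vecMul_vecMul, mem_D2, mem_D1]
  ext1 i; fin_cases i
  · show (v 0 * (a - 1) + v 1 * (z - 1)) * N + (-(v 1 * N) + v 3 * (z * b * (u + 1))) * (z - 1) +
      (v 2 * (u - 1) + v 3 * (b - 1)) * V = 0
    have : (v 0 * (a - 1) + v 1 * (z - 1)) * N + (-(v 1 * N) + v 3 * (z * b * (u + 1))) * (z - 1) +
      (v 2 * (u - 1) + v 3 * (b - 1)) * V = v 0 * ((a - 1) * N) +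
        v 1 * ((z - 1) * N - N * (z - 1)) + v 2 * ((u - 1) * V) +
        v 3 * (z * b * (u + 1) * (z - 1) + (b - 1) * V) := by
      generalize a - 1 = A; generalize b - 1 = B; generalize u + 1 = C; generalize z - 1 = Z
      generalize u - 1 = C'
      noncomm_ring
    rw [this, a_N, N_z, dd_f3V, dd_h3V]; simp
  · show -((-(v 1 * N) + v 3 * (z * b * (u + 1))) * ((a - 1) * (g + 1))) +
      (v 2 * (u - 1) + v 3 * (b - 1)) * E = 0
    have : -((-(v 1 * N) + v 3 * (z * b * (u + 1))) * ((a - 1) * (g + 1))) +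
      (v 2 * (u - 1) + v 3 * (b - 1)) * E = v 1 * (N * (a - 1)) * (g + 1) + v 2 * ((u - 1) * E) +
        v 3 * (z * b * (u + 1) * (-((a - 1) * (g + 1))) + (b - 1) * E) := by
      generalize a - 1 = A; generalize b - 1 = B; generalize u + 1 = C; generalize g + 1 = Z
      generalize u - 1 = C'
      noncomm_ring
    rw [this, N_a, dd_f3E, dd_h3E]; simp

lemma c1 (x y : R6) : (x * N + y * (z - 1)) * (a - 1) + -(y * (a - 1)) * (z - 1) = 0 := by
  have : (x * N + y * (z - 1)) * (a - 1) + -(y * (a - 1)) * (z - 1) = x * (N * (a - 1)) +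
    y * ((z - 1) * (a - 1) - (a - 1) * (z - 1)) := by
    generalize a - 1 = A; generalize z - 1 = Z
    noncomm_ring
  rw [this, N_a, a1_z]; simp

lemma c2 (x y : R6) : (x * (a - 1) + y * (z - 1)) * N + -(y * N) * (z - 1) = 0 := by
  have : (x * (a - 1) + y * (z - 1)) * N + -(y * N) * (z - 1) = x * ((a - 1) * N) +
    y * ((z - 1) * N - N * (z - 1)) := by
    generalize a - 1 = A; generalize z - 1 = Z
    noncomm_ring
  rw [this, a_N, N_z]; simp

lemma c3 (x y : R6) : (x * (u + 1) + y * (b - 1)) * (u - 1) + -(y * (u - 1)) * (b - 1) = 0 := by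
  have : (x * (u + 1) + y * (b - 1)) * (u - 1) + -(y * (u - 1)) * (b - 1) =
    x * ((u + 1) * (u - 1)) + y * ((b - 1) * (u - 1) - (u - 1) * (b - 1)) := by
    generalize b - 1 = A; generalize u - 1 = Z; generalize u + 1 = Z'
    noncomm_ring
  rw [this, uu2, bu2]; simp

lemma c4 (x y : R6) : (x * (u - 1) + y * (b - 1)) * (u + 1) + -(y * (u + 1)) * (b - 1) = 0 := by
  have : (x * (u - 1) + y * (b - 1)) * (u + 1) + -(y * (u + 1)) * (b - 1) =
    x * ((u - 1) * (u + 1)) + y * ((b - 1) * (u + 1) - (u + 1) * (b - 1)) := by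
    generalize b - 1 = A; generalize u - 1 = Z; generalize u + 1 = Z'
    noncomm_ring
  rw [this, uu1, bu1]; simp

lemma sq_A2 : DA * D2 = 0 := by
  apply eq_zero_of_vecMul; intro v
  rw [← Matrix.vecMul_vecMul, mem_DA, mem_D2]
  ext1 i; fin_cases i
  · exact c1 _ _
  · show -(-(v 1 * (a - 1)) * N) + -(v 3 * (u - 1)) * (z * b * (u + 1)) = 0
    rw [zbu, neg_mul, neg_mul, mul_assoc, a_N, mul_assoc, ← mul_assoc (u - 1), uu1]; simp
  · exact c3 _ _

lemma sq_AB : DA * DB = 0 := by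
  apply eq_zero_of_vecMul; intro v
  rw [← Matrix.vecMul_vecMul, mem_DA, mem_DB]
  ext1 i; fin_cases i
  · exact c1 _ _
  · show -(-(v 1 * (a - 1)) * N) = 0
    rw [neg_mul, mul_assoc, a_N]; simp
  · exact c3 _ _
  · show -(-(v 3 * (u - 1)) * (u + 1)) = 0
    rw [neg_mul, mul_assoc, uu1]; simp

lemma sq_BA : DB * DA = 0 := by
  apply eq_zero_of_vecMul; intro v
  rw [← Matrix.vecMul_vecMul, mem_DB, mem_DA]
  ext1 i; fin_cases i
  · exact c2 _ _
  · show -(-(v 1 * N) * (a - 1)) = 0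
    rw [neg_mul, mul_assoc, N_a]; simp
  · exact c4 _ _
  · show -(-(v 3 * (u + 1)) * (u - 1)) = 0
    rw [neg_mul, mul_assoc, uu2]; simp

/-- ranks -/
def rk : ℕ → ℕ
  | 0 => 1
  | 1 => 2
  | 2 => 3
  | _ + 3 => 4

/-- alternating differentials -/
noncomputable def Dalt (n : ℕ) : Matrix (Fin 4) (Fin 4) R6 := if Even n then DA else DB

/-- all differentials -/
noncomputable def Dm : ∀ n, Matrix (Fin (rk (n + 1))) (Fin (rk n)) R6
  | 0 => D0
  | 1 => D1
  | 2 => D2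
  | n + 3 => Dalt n

/-- The free resolution for `Gamma6`. -/
noncomputable def dat : FreeRes.Data Gamma6 where
  r := rk
  D := Dm
  sq
    | 0 => sq_10
    | 1 => sq_21
    | 2 => by
      have : Dalt 0 * D2 = 0 := by simpa [Dalt] using sq_A2
      exact this
    | n + 3 => by
      have : Dalt (n + 1) * Dalt n = 0 := by
        by_cases h : Even n
        · simpa [Dalt, h, Nat.even_add_one] using sq_BA
        · simpa [Dalt, h, Nat.even_add_one] using sq_AB
      exact this
  ex
    | 0 => ex_01
    | 1 => ex_12
    | 2 => by
      have : ∀ v, Matrix.vecMul v D2 = 0 → ∃ w, v = Matrix.vecMul w (Dalt 0) := by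
        simpa [Dalt] using ex_2A
      exact this
    | n + 3 => by
      have : ∀ v, Matrix.vecMul v (Dalt n) = 0 → ∃ w, v = Matrix.vecMul w (Dalt (n + 1)) := by
        by_cases h : Even n
        · simpa [Dalt, h, Nat.even_add_one] using ex_AB
        · simpa [Dalt, h, Nat.even_add_one] using ex_BA
      exact this
  aug0 := by
    have : ∀ w, ∑ i, aug Gamma6 (Matrix.vecMul w D0 i) = 0 := by
      intro w
      rw [mem_D0]
      simp [aug_a, aug_g]
    exact this
  exaug := by
    have : ∀ v : Fin 1 → R6, ∑ i, aug Gamma6 (v i) = 0 → ∃ w, v = Matrix.vecMul w D0 := by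
      intro v h
      rw [Fin.sum_univ_one] at h
      obtain ⟨p, q, hpq⟩ := mod_aug (v 0)
      refine ⟨![p, q], ?_⟩
      rw [h, Int.cast_zero, sub_zero] at hpq
      rw [mem_D0]
      ext1 i; fin_cases i
      exact hpq
    exact this
  pos := Nat.one_pos

lemma aug_N : aug Gamma6 N = 4 := by simp [N, aug_a]
lemma aug_V : aug Gamma6 V = -4 := by simp [V, aug_z, aug_b, aug_u]
lemma aug_E : aug Gamma6 E = 0 := by simp [E, Nb, W, aug_z, aug_b, aug_g]

lemma dual0 (f : Fin 1 → ℤ) : FreeRes.dual dat 0 f = (![0, 0] : Fin 2 → ℤ) := by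
  have : (fun i => ∑ j, aug Gamma6 (D0 i j) * f j) = ![0, 0] := by
    ext i; fin_cases i <;> simp [D0, aug_a, aug_g]
  exact this

lemma dual1 (f : Fin 2 → ℤ) : FreeRes.dual dat 1 f = (![4 * f 0, 0, -4 * f 0] : Fin 3 → ℤ) := by
  have : (fun i => ∑ j, aug Gamma6 (D1 i j) * f j) = ![4 * f 0, 0, -4 * f 0] := by
    ext i; fin_cases i <;> simp [D1, Fin.sum_univ_succ, aug_a, aug_g, aug_N, aug_V, aug_E, aug_z]
  exact this

lemma dual2 (f : Fin 3 → ℤ) :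
    FreeRes.dual dat 2 f = (![0, -4 * f 1, 0, 2 * f 1] : Fin 4 → ℤ) := by
  have : (fun i => ∑ j, aug Gamma6 (D2 i j) * f j) = ![0, -4 * f 1, 0, 2 * f 1] := by
    ext i; fin_cases i <;> simp [D2, Fin.sum_univ_succ, aug_a, aug_N, aug_z, aug_u, aug_b]
  exact this

lemma dualA (n : ℕ) (h : Even n) (f : Fin 4 → ℤ) :
    FreeRes.dual dat (n + 3) f = (![4 * f 0, 0, 2 * f 2, 0] : Fin 4 → ℤ) := by
  have : (fun i => ∑ j, aug Gamma6 (Dalt n i j) * f j) = ![4 * f 0, 0, 2 * f 2, 0] := by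
    ext i; fin_cases i <;>
      simp [DA, Dalt, h, Fin.sum_univ_succ, aug_a, aug_N, aug_z, aug_u, aug_b]
  exact this

lemma dualB (n : ℕ) (h : ¬ Even n) (f : Fin 4 → ℤ) :
    FreeRes.dual dat (n + 3) f = (![0, -4 * f 1, 0, -2 * f 3] : Fin 4 → ℤ) := by
  have : (fun i => ∑ j, aug Gamma6 (Dalt n i j) * f j) = ![0, -4 * f 1, 0, -2 * f 3] := by
    ext i; fin_cases i <;>
      simp [DB, Dalt, h, Fin.sum_univ_succ, aug_a, aug_N, aug_z, aug_u, aug_b]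
  exact this

end G6
namespace G6

lemma zc (m : ℕ) (x : ℤ) : (Int.castAddHom (ZMod m)) x = 0 ↔ (m : ℤ) ∣ x :=
  ZMod.intCast_zmod_eq_zero_iff_dvd x m

lemma alg0 : (∀ y : ℤ, ∃ x : Fin 1 → ℤ, (![0, 0] : Fin 2 → ℤ) = 0 ∧
      Pi.evalAddMonoidHom (fun _ : Fin 1 => ℤ) 0 x = y) ∧
    (∀ x : Fin 1 → ℤ, Pi.evalAddMonoidHom (fun _ : Fin 1 => ℤ) 0 x = 0 ↔ x = 0) := by
  refine ⟨fun y => ⟨fun _ => y, by simp, rfl⟩, fun x => ⟨fun h => ?_, fun h => by rw [h]; rfl⟩⟩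
  ext i; fin_cases i; exact h

theorem H0 : Nonempty ((groupCohomology (Rep.trivial ℤ Gamma6 ℤ) 0) ≃+ ℤ) := by
  refine FreeRes.cohomology_zero dat (Pi.evalAddMonoidHom (fun _ : Fin 1 => ℤ) 0) ?_ ?_
  · intro y
    obtain ⟨x, hx, h⟩ := alg0.1 y
    exact ⟨x, (dual0 x).trans hx, h⟩
  · intro x _
    exact alg0.2 x

theorem H1 : Nonempty ((groupCohomology (Rep.trivial ℤ Gamma6 ℤ) 1) ≃+ ℤ) := by
  refine FreeRes.cohomology_succ dat 0 (Pi.evalAddMonoidHom (fun _ : Fin 2 => ℤ) 1) ?_ ?_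
  · intro y
    refine ⟨(![0, y] : Fin 2 → ℤ), (dual1 _).trans ?_, rfl⟩
    exact (by simp : (![4 * (![0, y] : Fin 2 → ℤ) 0, 0, -4 * (![0, y] : Fin 2 → ℤ) 0]
      : Fin 3 → ℤ) = 0)
  · have key : ∀ x : Fin 2 → ℤ, (![4 * x 0, 0, -4 * x 0] : Fin 3 → ℤ) = 0 →
        (x 1 = 0 ↔ ∃ w : Fin 1 → ℤ, (![0, 0] : Fin 2 → ℤ) = x) := by
      intro x hx
      have h0 : 4 * x 0 = 0 := congrFun hx 0
      constructor
      · intro h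
        refine ⟨0, ?_⟩
        ext i; fin_cases i
        · show 0 = x 0
          omega
        · exact h.symm
      · rintro ⟨w, rfl⟩; rfl
    intro x hx
    refine (key x ((dual1 x).symm.trans hx)).trans ?_
    exact exists_congr fun w => by rw [dual0]; rfl

theorem H2 : Nonempty ((groupCohomology (Rep.trivial ℤ Gamma6 ℤ) 2) ≃+ (ZMod 4 × ℤ)) := by
  refine FreeRes.cohomology_succ dat 1 (AddMonoidHom.prod
    ((Int.castAddHom (ZMod 4)).comp (Pi.evalAddMonoidHom (fun _ : Fin 3 => ℤ) 0))
    (Pi.evalAddMonoidHom (fun _ : Fin 3 => ℤ) 0 + Pi.evalAddMonoidHom (fun _ : Fin 3 => ℤ) 2)) ?_ ?_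
  · rintro ⟨c, m⟩
    obtain ⟨c, rfl⟩ := ZMod.intCast_surjective c
    refine ⟨(![c, 0, m - c] : Fin 3 → ℤ), (dual2 _).trans ?_, ?_⟩
    · exact (by simp : (![0, -4 * (![c, 0, m - c] : Fin 3 → ℤ) 1, 0,
        2 * (![c, 0, m - c] : Fin 3 → ℤ) 1] : Fin 4 → ℤ) = 0)
    · exact Prod.ext rfl (show c + (m - c) = m by ring)
  · have key : ∀ x : Fin 3 → ℤ, (![0, -4 * x 1, 0, 2 * x 1] : Fin 4 → ℤ) = 0 →
        ((Int.castAddHom (ZMod 4) (x 0), x 0 + x 2) = (0 : ZMod 4 × ℤ) ↔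
          ∃ w : Fin 2 → ℤ, (![4 * w 0, 0, -4 * w 0] : Fin 3 → ℤ) = x) := by
      intro x hx
      have h0 : 2 * x 1 = 0 := congrFun hx 3
      rw [Prod.mk_eq_zero, zc]
      constructor
      · rintro ⟨⟨k, hk⟩, h⟩
        push_cast at hk
        refine ⟨![k, 0], ?_⟩
        ext i; fin_cases i
        · exact hk.symm
        · show 0 = x 1
          omega
        · show -4 * k = x 2
          omega
      · rintro ⟨w, rfl⟩
        exact ⟨⟨w 0, rfl⟩, show 4 * w 0 + -4 * w 0 = 0 by ring⟩
    intro x hx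
    refine Iff.trans (key x ((dual2 x).symm.trans hx)) ?_
    exact exists_congr fun w => by rw [dual1]; rfl

theorem H3 : Nonempty ((groupCohomology (Rep.trivial ℤ Gamma6 ℤ) 3) ≃+ (ZMod 2 × ℤ)) := by
  refine FreeRes.cohomology_succ dat 2 (AddMonoidHom.prod
    ((Int.castAddHom (ZMod 2)).comp (Pi.evalAddMonoidHom (fun _ : Fin 4 => ℤ) 3))
    (Pi.evalAddMonoidHom (fun _ : Fin 4 => ℤ) 1 + (Pi.evalAddMonoidHom (fun _ : Fin 4 => ℤ) 3 +
      Pi.evalAddMonoidHom (fun _ : Fin 4 => ℤ) 3))) ?_ ?_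
  · rintro ⟨c, m⟩
    obtain ⟨c, rfl⟩ := ZMod.intCast_surjective c
    refine ⟨(![0, m - 2 * c, 0, c] : Fin 4 → ℤ), (dualA 0 (by decide) _).trans ?_, ?_⟩
    · exact (by simp : (![4 * (![0, m - 2 * c, 0, c] : Fin 4 → ℤ) 0, 0,
        2 * (![0, m - 2 * c, 0, c] : Fin 4 → ℤ) 2, 0] : Fin 4 → ℤ) = 0)
    · exact Prod.ext rfl (show (m - 2 * c) + (c + c) = m by ring)
  · have key : ∀ x : Fin 4 → ℤ, (![4 * x 0, 0, 2 * x 2, 0] : Fin 4 → ℤ) = 0 →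
        ((Int.castAddHom (ZMod 2) (x 3), x 1 + (x 3 + x 3)) = (0 : ZMod 2 × ℤ) ↔
          ∃ w : Fin 3 → ℤ, (![0, -4 * w 1, 0, 2 * w 1] : Fin 4 → ℤ) = x) := by
      intro x hx
      have h0 : 4 * x 0 = 0 := congrFun hx 0
      have h2 : 2 * x 2 = 0 := congrFun hx 2
      rw [Prod.mk_eq_zero, zc]
      constructor
      · rintro ⟨⟨k, hk⟩, h⟩
        push_cast at hk
        refine ⟨![0, k, 0], ?_⟩
        ext i; fin_cases i
        · show 0 = x 0
          omega
        · show -4 * k = x 1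
          omega
        · show 0 = x 2
          omega
        · exact hk.symm
      · rintro ⟨w, rfl⟩
        exact ⟨⟨w 1, rfl⟩, show -4 * w 1 + (2 * w 1 + 2 * w 1) = 0 by ring⟩
    intro x hx
    refine Iff.trans (key x ((dualA 0 (by decide) x).symm.trans hx)) ?_
    exact exists_congr fun w => by rw [dual2]; rfl

theorem Hhigh (n : ℕ) :
    Nonempty ((groupCohomology (Rep.trivial ℤ Gamma6 ℤ) (n + 4)) ≃+ (ZMod 4 × ZMod 2)) := by
  by_cases hn : Even n
  · have hn' : ¬ Even (n + 1) := by rwa [Nat.even_add_one, not_not]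
    refine FreeRes.cohomology_succ dat (n + 3) (AddMonoidHom.prod
      ((Int.castAddHom (ZMod 4)).comp (Pi.evalAddMonoidHom (fun _ : Fin 4 => ℤ) 0))
      ((Int.castAddHom (ZMod 2)).comp (Pi.evalAddMonoidHom (fun _ : Fin 4 => ℤ) 2))) ?_ ?_
    · rintro ⟨c, m⟩
      obtain ⟨c, rfl⟩ := ZMod.intCast_surjective c
      obtain ⟨m, rfl⟩ := ZMod.intCast_surjective m
      refine ⟨(![c, 0, m, 0] : Fin 4 → ℤ), (dualB (n + 1) hn' _).trans ?_, rfl⟩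
      exact (by simp : (![0, -4 * (![c, 0, m, 0] : Fin 4 → ℤ) 1, 0,
        -2 * (![c, 0, m, 0] : Fin 4 → ℤ) 3] : Fin 4 → ℤ) = 0)
    · have key : ∀ x : Fin 4 → ℤ, (![0, -4 * x 1, 0, -2 * x 3] : Fin 4 → ℤ) = 0 →
          ((Int.castAddHom (ZMod 4) (x 0), Int.castAddHom (ZMod 2) (x 2)) =
            (0 : ZMod 4 × ZMod 2) ↔
            ∃ w : Fin 4 → ℤ, (![4 * w 0, 0, 2 * w 2, 0] : Fin 4 → ℤ) = x) := by
        intro x hx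
        have h1 : -4 * x 1 = 0 := congrFun hx 1
        have h3 : -2 * x 3 = 0 := congrFun hx 3
        rw [Prod.mk_eq_zero, zc, zc]
        constructor
        · rintro ⟨⟨k, hk⟩, ⟨l, hl⟩⟩
          refine ⟨![k, 0, l, 0], ?_⟩
          ext i; fin_cases i
          · exact hk.symm
          · show 0 = x 1
            omega
          · exact hl.symm
          · show 0 = x 3
            omega
        · rintro ⟨w, rfl⟩
          exact ⟨⟨w 0, rfl⟩, ⟨w 2, rfl⟩⟩
      intro x hx
      refine Iff.trans (key x ((dualB (n + 1) hn' x).symm.trans hx)) ?_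
      exact exists_congr fun w => by rw [dualA n hn]; rfl
  · have hn' : Even (n + 1) := by rwa [Nat.even_add_one]
    refine FreeRes.cohomology_succ dat (n + 3) (AddMonoidHom.prod
      ((Int.castAddHom (ZMod 4)).comp (Pi.evalAddMonoidHom (fun _ : Fin 4 => ℤ) 1))
      ((Int.castAddHom (ZMod 2)).comp (Pi.evalAddMonoidHom (fun _ : Fin 4 => ℤ) 3))) ?_ ?_
    · rintro ⟨c, m⟩
      obtain ⟨c, rfl⟩ := ZMod.intCast_surjective c
      obtain ⟨m, rfl⟩ := ZMod.intCast_surjective m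
      refine ⟨(![0, c, 0, m] : Fin 4 → ℤ), (dualA (n + 1) hn' _).trans ?_, rfl⟩
      exact (by simp : (![4 * (![0, c, 0, m] : Fin 4 → ℤ) 0, 0,
        2 * (![0, c, 0, m] : Fin 4 → ℤ) 2, 0] : Fin 4 → ℤ) = 0)
    · have key : ∀ x : Fin 4 → ℤ, (![4 * x 0, 0, 2 * x 2, 0] : Fin 4 → ℤ) = 0 →
          ((Int.castAddHom (ZMod 4) (x 1), Int.castAddHom (ZMod 2) (x 3)) =
            (0 : ZMod 4 × ZMod 2) ↔
            ∃ w : Fin 4 → ℤ, (![0, -4 * w 1, 0, -2 * w 3] : Fin 4 → ℤ) = x) := by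
        intro x hx
        have h0 : 4 * x 0 = 0 := congrFun hx 0
        have h2 : 2 * x 2 = 0 := congrFun hx 2
        rw [Prod.mk_eq_zero, zc, zc]
        constructor
        · rintro ⟨⟨k, hk⟩, ⟨l, hl⟩⟩
          push_cast at hk hl
          refine ⟨![0, -k, 0, -l], ?_⟩
          ext i; fin_cases i
          · show 0 = x 0
            omega
          · show -4 * -k = x 1
            omega
          · show 0 = x 2
            omega
          · show -2 * -l = x 3
            omega
        · rintro ⟨w, rfl⟩
          exact ⟨⟨-w 1, show -4 * w 1 = 4 * -w 1 by ring⟩,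
            ⟨-w 3, show -2 * w 3 = 2 * -w 3 by ring⟩⟩
      intro x hx
      refine Iff.trans (key x ((dualA (n + 1) hn' x).symm.trans hx)) ?_
      exact exists_congr fun w => by rw [dualB n hn]; rfl

end G6

/-- the integral cohomology of `Γ₆ = ℤ³ ⋊ ℤ/4` is `ℤ` in degrees `0, 1`,
`ℤ/4 ⊕ ℤ` in degree `2`, `ℤ/2 ⊕ ℤ` in degree `3`, and `ℤ/4 ⊕ ℤ/2` in degrees `≥ 4`. -/
theorem Gamma6_cohomology :
    Nonempty ((groupCohomology (Rep.trivial ℤ Gamma6 ℤ) 0) ≃+ ℤ) ∧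
    Nonempty ((groupCohomology (Rep.trivial ℤ Gamma6 ℤ) 1) ≃+ ℤ) ∧
    Nonempty ((groupCohomology (Rep.trivial ℤ Gamma6 ℤ) 2) ≃+ (ZMod 4 × ℤ)) ∧
    Nonempty ((groupCohomology (Rep.trivial ℤ Gamma6 ℤ) 3) ≃+ (ZMod 2 × ℤ)) ∧
    ∀ i : ℕ, 4 ≤ i →
      Nonempty ((groupCohomology (Rep.trivial ℤ Gamma6 ℤ) i) ≃+ (ZMod 4 × ZMod 2)) := by
  refine ⟨G6.H0, G6.H1, G6.H2, G6.H3, fun i hi => ?_⟩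
  obtain ⟨n, rfl⟩ := Nat.exists_eq_add_of_le hi
  rw [add_comm 4 n]
  exact G6.Hhigh n
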